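/- arXiv:2301.05121 — 2 statements merged into one kernel-verified Lean document; each statement's English description precedes it below -/
import Mathlib

section
/- Taylor's theorem on homogeneous Lie groups with explicit remainder measures: Let 𝔾 be a homogeneous Lie group of homogeneous dimension |𝔰| with homogeneous norm |·|. For each a > 0 there exists β > 0 depending only on 𝔾 such that the following holds: for every multi-index I ∈ ℕ^d with |I| ≤ [a]+1 and d(I) ≥ a and every y ∈ 𝔾 there is a finite signed measure Q^I(y,·) on 𝔾, supported in the ball B_{β^{[a]+1}|y|}(e), whose total variation satisfies ∫_𝔾 |Q^I(y,dz)| ≲ |y|^{d(I)} uniformly in y, and such that for every f ∈ C^∞(𝔾) and all x, y ∈ 𝔾: f(xy) − P^a_x[f](y) = Σ_{|I| ≤ [a]+1, d(I) ≥ a} ∫_𝔾 X^I f(xz) Q^I(y,dz). -/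
open Set
noncomputable section
attribute [local instance] Classical.propDecidable

namespace HomLie

/-- The underlying carrier of a homogeneous Lie group: `ℝ^d`, identified with the Lie
algebra via the exponential map (exponential coordinates of the first kind). -/
abbrev Gc (d : ℕ) := Fin d → ℝ

/-- A homogeneous Lie group structure on `ℝ^d`: a simply connected nilpotent Lie group in
exponential coordinates (polynomial, hence smooth, group law; Haar measure = Lebesgue
measure), with dilations generated by a diagonal map `𝔰` with eigenvalues
`1 = 𝔰₁ ≤ ⋯ ≤ 𝔰_d` (in the coordinates given by the eigenbasis), and a homogeneous
(quasi-)norm. -/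
structure HLG (d : ℕ) where
  mul : Gc d → Gc d → Gc d
  one : Gc d
  inv : Gc d → Gc d
  one_eq_zero : one = fun _ => (0 : ℝ)
  mul_assoc' : ∀ x y z, mul (mul x y) z = mul x (mul y z)
  one_mul' : ∀ x, mul one x = x
  mul_one' : ∀ x, mul x one = x
  inv_mul' : ∀ x, mul (inv x) x = one
  mul_inv' : ∀ x, mul x (inv x) = one
  smooth_mul : ContDiff ℝ (⊤ : ℕ∞) fun p : Gc d × Gc d => mul p.1 p.2
  smooth_inv : ContDiff ℝ (⊤ : ℕ∞) inv
  s : Fin d → ℝ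
  s_mono : Monotone s
  one_le_s : ∀ i, 1 ≤ s i
  s_min : ∀ h : 0 < d, s ⟨0, h⟩ = 1
  dil_mul : ∀ r : ℝ, 0 < r → ∀ x y,
    (fun i => r ^ s i * mul x y i) = mul (fun i => r ^ s i * x i) (fun i => r ^ s i * y i)
  hnorm : Gc d → ℝ
  hnorm_nonneg : ∀ x, 0 ≤ hnorm x
  hnorm_cont : Continuous hnorm
  hnorm_eq_zero : ∀ x, hnorm x = 0 ↔ x = one
  hnorm_inv : ∀ x, hnorm (inv x) = hnorm x
  hnorm_dil : ∀ r : ℝ, 0 < r → ∀ x, hnorm (fun i => r ^ s i * x i) = r * hnorm x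
  mu : ℝ
  one_le_mu : 1 ≤ mu
  hnorm_mul_le : ∀ x y, hnorm (mul x y) ≤ mu * (hnorm x + hnorm y)

namespace HLG

variable {d : ℕ}

/-- The dilation `x ↦ r · x`. -/
def dil (Γ : HLG d) (r : ℝ) (x : Gc d) : Gc d := fun i => r ^ Γ.s i * x i

/-- The left-invariant (semi-)distance `d(x,y) = |x⁻¹ y|`. -/
def gdist (Γ : HLG d) (x y : Gc d) : ℝ := Γ.hnorm (Γ.mul (Γ.inv x) y)

/-- The ball `B_r(x)` for the homogeneous norm. -/
def ball (Γ : HLG d) (x : Gc d) (r : ℝ) : Set (Gc d) := {y | Γ.gdist x y < r}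

/-- Homogeneous dimension `|𝔰| = 𝔰₁ + ⋯ + 𝔰_d`. -/
def sdim (Γ : HLG d) : ℝ := ∑ i, Γ.s i

/-- The left-invariant vector field `X_i f (y) = ∂_t f(y · exp(t X_i))|_{t=0}`. In
exponential coordinates `exp (t X_i) = Pi.single i t`. -/
def X (Γ : HLG d) (i : Fin d) (f : Gc d → ℝ) (y : Gc d) : ℝ :=
  deriv (fun t : ℝ => f (Γ.mul y (Pi.single i t))) 0

/-- The right-invariant vector field `Y_i f (y) = ∂_t f(exp(t X_i) · y)|_{t=0}`. -/
def Yr (Γ : HLG d) (i : Fin d) (f : Gc d → ℝ) (y : Gc d) : ℝ :=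
  deriv (fun t : ℝ => f (Γ.mul (Pi.single i t) y)) 0

/-- Iterated left-invariant derivative `X^I = X₁^{i₁} ⋯ X_d^{i_d}` (in this order). -/
def XI (Γ : HLG d) (I : Fin d → ℕ) (f : Gc d → ℝ) : Gc d → ℝ :=
  (((List.finRange d).map fun j => (Γ.X j)^[I j]).foldr (fun g h => g ∘ h) id) f

/-- Iterated left-invariant derivative in reversed order `X_d^{i_d} ⋯ X₁^{i₁}`. -/
def XIrev (Γ : HLG d) (I : Fin d → ℕ) (f : Gc d → ℝ) : Gc d → ℝ :=
  (((List.finRange d).map fun j => (Γ.X j)^[I j]).foldl (fun h g => g ∘ h) id) f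

/-- Homogeneous degree `d(I) = Σ_j 𝔰_j i_j` of a multi-index. -/
def dI (Γ : HLG d) (I : Fin d → ℕ) : ℝ := ∑ j, Γ.s j * (I j : ℝ)

/-- Isotropic degree `|I| = Σ_j i_j` of a multi-index. -/
def absI {d : ℕ} (I : Fin d → ℕ) : ℕ := ∑ j, I j

/-- Monomial `η^I(x) = Π_j η_j(x)^{i_j}`; in exponential coordinates `η_j(x) = x j`. -/
def etaI {d : ℕ} (I : Fin d → ℕ) (x : Gc d) : ℝ := ∏ j, x j ^ I j

/-- The (finite) set of multi-indices `I` with `|I| ≤ n`. -/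
def multiIdxLe (d n : ℕ) : Finset (Fin d → ℕ) :=
  ((Finset.univ : Finset (Fin d → Fin (n + 1))).image fun g j => (g j : ℕ)).filter
    fun I => ∑ j, I j ≤ n

/-- The polynomial with (finitely supported) coefficients `c`. -/
def polyFun {d : ℕ} (c : (Fin d → ℕ) →₀ ℝ) : Gc d → ℝ := fun z => c.sum fun I a => a * etaI I z

/-- `P` is a polynomial of homogeneous degree `< a`. -/
def IsPolyBelow (Γ : HLG d) (a : ℝ) (P : Gc d → ℝ) : Prop :=
  ∃ c : (Fin d → ℕ) →₀ ℝ, (∀ I ∈ c.support, Γ.dI I < a) ∧ P = polyFun c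

/-- `P` is the left Taylor polynomial of homogeneous degree (less than) `a` of `f` at `x`:
the unique `P ∈ 𝒫_a` with `X^I P(e) = X^I f(x)` for all `d(I) < a`. -/
def IsTaylorAt (Γ : HLG d) (a : ℝ) (f : Gc d → ℝ) (x : Gc d) (P : Gc d → ℝ) : Prop :=
  IsPolyBelow Γ a P ∧ ∀ I : Fin d → ℕ, Γ.dI I < a → Γ.XI I P Γ.one = Γ.XI I f x

/-- Test functions: smooth and compactly supported. -/
def IsTest {d : ℕ} (φ : Gc d → ℝ) : Prop := ContDiff ℝ (⊤ : ℕ∞) φ ∧ HasCompactSupport φ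

/-- The class `𝔅_r` of test functions supported in `B₁(e)` with `|X^I φ| ≤ 1` for
`d(I) ≤ r`. -/
def testClass (Γ : HLG d) (r : ℝ) : Set (Gc d → ℝ) :=
  {φ | ContDiff ℝ (⊤ : ℕ∞) φ ∧ (∀ z, φ z ≠ 0 → Γ.hnorm z < 1) ∧
    ∀ I : Fin d → ℕ, Γ.dI I ≤ r → ∀ z, |Γ.XI I φ z| ≤ 1}

/-- The rescaled and recentred test function `φ^λ_x(z) = λ^{-|𝔰|} φ(λ⁻¹ · (x⁻¹ z))`. -/
def scaleTest (Γ : HLG d) (φ : Gc d → ℝ) (lam : ℝ) (x : Gc d) : Gc d → ℝ :=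
  fun z => lam ^ (-Γ.sdim) * φ (Γ.dil lam⁻¹ (Γ.mul (Γ.inv x) z))

/-- Group convolution `(ψ * φ)(x) = ∫ ψ(y) φ(y⁻¹ x) dy` (Haar = Lebesgue measure). -/
def conv (Γ : HLG d) (ψ φ : Gc d → ℝ) : Gc d → ℝ :=
  fun x => ∫ y, ψ y * φ (Γ.mul (Γ.inv y) x)

/-- The distribution pairing of a locally integrable function. -/
def pairFun {d : ℕ} (f : Gc d → ℝ) : (Gc d → ℝ) → ℝ := fun φ => ∫ z, f z * φ z

/-- The `1`-fattening of a set. -/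
def fatten (Γ : HLG d) (K : Set (Gc d)) : Set (Gc d) := {z | ∃ y ∈ K, Γ.gdist y z ≤ 1}

end HLG

end HomLie

namespace HomLie
open HLG MeasureTheory

namespace TT

variable {d : ℕ} (Γ : HLG d)

lemma one0 : Γ.one = 0 := Γ.one_eq_zero
lemma zmul (x : Gc d) : Γ.mul 0 x = x := by rw [← one0 Γ]; exact Γ.one_mul' x
lemma mulz (x : Gc d) : Γ.mul x 0 = x := by rw [← one0 Γ]; exact Γ.mul_one' x
lemma invmul (x : Gc d) : Γ.mul (Γ.inv x) x = 0 := by rw [Γ.inv_mul', one0]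
lemma mulinvmul (x y : Gc d) : Γ.mul x (Γ.mul (Γ.inv x) y) = y := by
  rw [← Γ.mul_assoc', Γ.mul_inv', Γ.one_mul']

lemma dilmul {r : ℝ} (hr : 0 < r) (x y : Gc d) :
    Γ.dil r (Γ.mul x y) = Γ.mul (Γ.dil r x) (Γ.dil r y) := Γ.dil_mul r hr x y

lemma dilsmul (r t : ℝ) (y : Gc d) : Γ.dil r (t • y) = t • Γ.dil r y := by
  funext i; simp [HLG.dil]; ring

lemma dil0 (r : ℝ) : Γ.dil r 0 = 0 := by funext i; simp [HLG.dil]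

lemma dilsingle (r : ℝ) (i : Fin d) (t : ℝ) :
    Γ.dil r (Pi.single i t) = Pi.single i (r ^ Γ.s i * t) := by
  funext j
  by_cases h : j = i
  · subst h; simp [HLG.dil]
  · simp [HLG.dil, h]

lemma dilinv {r : ℝ} (hr : 0 < r) (x : Gc d) : Γ.dil r (Γ.inv x) = Γ.inv (Γ.dil r x) := by
  have h : Γ.mul (Γ.dil r (Γ.inv x)) (Γ.dil r x) = 0 := by
    rw [← dilmul Γ hr, invmul, dil0]
  calc Γ.dil r (Γ.inv x) = Γ.mul (Γ.dil r (Γ.inv x)) (Γ.mul (Γ.dil r x) (Γ.inv (Γ.dil r x))) := by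
        rw [Γ.mul_inv', Γ.mul_one']
    _ = _ := by rw [← Γ.mul_assoc', h, zmul]

lemma hnorm0 : Γ.hnorm 0 = 0 := by rw [Γ.hnorm_eq_zero, one0]

/-- Every nonzero vector can be dilated to the Euclidean (sup) unit sphere. -/
lemma exists_dil (y : Gc d) (hy : y ≠ 0) : ∃ r : ℝ, 0 < r ∧ ‖Γ.dil r y‖ = 1 := by
  obtain ⟨i, hi⟩ : ∃ i, y i ≠ 0 := by
    by_contra h; push Not at h; exact hy (funext h)
  have hs : ∀ i, 0 < Γ.s i := fun i => lt_of_lt_of_le one_pos (Γ.one_le_s i)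
  have hc : Continuous fun r : ℝ => ‖Γ.dil r y‖ := by
    refine Continuous.norm (continuous_pi fun j => ?_)
    exact (Real.continuous_rpow_const (hs j).le).mul continuous_const
  set R : ℝ := max 1 (1 / |y i|) with hR
  have hR1 : 1 ≤ R := le_max_left _ _
  have h0 : ‖Γ.dil 0 y‖ = 0 := by
    rw [norm_eq_zero]; funext j; simp [HLG.dil, Real.zero_rpow (hs j).ne']
  have h1 : 1 ≤ ‖Γ.dil R y‖ := by
    refine le_trans ?_ (norm_le_pi_norm (Γ.dil R y) i)
    have h2 : R ≤ R ^ Γ.s i := by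
      conv_lhs => rw [← Real.rpow_one R]
      exact Real.rpow_le_rpow_of_exponent_le hR1 (Γ.one_le_s i)
    have h3 : 0 < |y i| := abs_pos.mpr hi
    simp only [HLG.dil, norm_mul, Real.norm_eq_abs]
    rw [abs_of_nonneg (by positivity)]
    calc 1 = 1 / |y i| * |y i| := by field_simp
      _ ≤ R * |y i| := by gcongr; exact le_max_right _ _
      _ ≤ _ := by gcongr
  obtain ⟨r, hr, hr1⟩ := intermediate_value_Icc (show (0:ℝ) ≤ R by linarith) hc.continuousOn
    (show (1:ℝ) ∈ Icc (‖Γ.dil 0 y‖) (‖Γ.dil R y‖) from ⟨by rw [h0]; norm_num, h1⟩)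
  refine ⟨r, lt_of_le_of_ne hr.1 ?_, hr1⟩
  rintro rfl
  simp only [h0] at hr1
  norm_num at hr1

/-- Homogeneous continuous functions are controlled by the homogeneous norm. -/
lemma hom_bound (F : ℝ × Gc d → ℝ) (hF : Continuous F) (δ : ℝ) (hδ : 0 < δ)
    (hh : ∀ r : ℝ, 0 < r → ∀ t y, F (t, Γ.dil r y) = r ^ δ * F (t, y)) :
    ∃ C : ℝ, 0 ≤ C ∧ ∀ y, ∀ t ∈ Icc (0:ℝ) 1, |F (t, y)| ≤ C * Γ.hnorm y ^ δ := by
  have hK : IsCompact ((Icc (0:ℝ) 1) ×ˢ (Metric.sphere (0 : Gc d) 1)) :=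
    isCompact_Icc.prod (isCompact_sphere _ _)
  obtain ⟨M, hM⟩ := hK.exists_bound_of_continuousOn hF.continuousOn
  obtain ⟨c, hc, hcb⟩ : ∃ c : ℝ, 0 < c ∧ ∀ u ∈ Metric.sphere (0 : Gc d) 1, c ≤ Γ.hnorm u := by
    by_cases hne : (Metric.sphere (0 : Gc d) 1).Nonempty
    · obtain ⟨u, hu, hmin⟩ := (isCompact_sphere (0 : Gc d) 1).exists_isMinOn hne
        Γ.hnorm_cont.continuousOn
      refine ⟨Γ.hnorm u, lt_of_le_of_ne (Γ.hnorm_nonneg u) ?_, fun v hv => hmin hv⟩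
      intro h
      have := (Γ.hnorm_eq_zero u).1 h.symm
      rw [one0] at this
      subst this
      simp at hu
    · exact ⟨1, one_pos, fun u hu => absurd ⟨u, hu⟩ hne⟩
  refine ⟨max M 0 * (c⁻¹) ^ δ, by positivity, fun y t ht => ?_⟩
  by_cases hy : y = 0
  · subst hy
    have h2 := hh 2 two_pos t 0
    rw [dil0] at h2
    have : (1:ℝ) < 2 ^ δ := Real.one_lt_rpow one_lt_two hδ
    have h3 : F (t, 0) = 0 := by
      have : (2 ^ δ - 1) * F (t, 0) = 0 := by linarith
      rcases mul_eq_zero.1 this with h | h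
      · linarith
      · exact h
    rw [h3, hnorm0, Real.zero_rpow hδ.ne']; simp
  · obtain ⟨r, hr, hr1⟩ := exists_dil Γ y hy
    have hu : Γ.dil r y ∈ Metric.sphere (0 : Gc d) 1 := by simpa using hr1
    have h1 := hM (t, Γ.dil r y) ⟨ht, hu⟩
    have h2 := hcb _ hu
    have h3 : Γ.hnorm (Γ.dil r y) = r * Γ.hnorm y := Γ.hnorm_dil r hr y
    rw [hh r hr, norm_mul, Real.norm_eq_abs, Real.norm_eq_abs,
      abs_of_pos (Real.rpow_pos_of_pos hr δ)] at h1
    rw [h3] at h2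
    have hrd := Real.rpow_pos_of_pos hr δ
    have h4 : 1 ≤ (c⁻¹) ^ δ * (r ^ δ * Γ.hnorm y ^ δ) := by
      rw [← Real.mul_rpow hr.le (Γ.hnorm_nonneg y),
        ← Real.mul_rpow (by positivity) (by have := Γ.hnorm_nonneg y; positivity)]
      apply Real.one_le_rpow _ hδ.le
      rw [inv_mul_eq_div, le_div_iff₀ hc]; linarith
    have h5 : r ^ δ * |F (t, y)| ≤ max M 0 := h1.trans (le_max_left _ _)
    have h6 : r ^ δ * |F (t, y)| ≤ r ^ δ * (max M 0 * c⁻¹ ^ δ * Γ.hnorm y ^ δ) := by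
      calc _ ≤ max M 0 * 1 := by linarith
        _ ≤ max M 0 * ((c⁻¹) ^ δ * (r ^ δ * Γ.hnorm y ^ δ)) := by gcongr
        _ = _ := by ring
    exact le_of_mul_le_mul_left h6 hrd

/-- uncurried multiplication -/
def m2 (p : Gc d × Gc d) : Gc d := Γ.mul p.1 p.2

lemma m2_smooth : ContDiff ℝ (⊤ : ℕ∞) (m2 Γ) := Γ.smooth_mul

lemma L_smooth (x : Gc d) : ContDiff ℝ (⊤ : ℕ∞) (fun y => Γ.mul x y) :=
  (m2_smooth Γ).comp (contDiff_const.prodMk contDiff_id)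

/-- left-invariant vector field with value `e_i` at the origin -/
def V (i : Fin d) (y : Gc d) : Gc d := fderiv ℝ (m2 Γ) (y, 0) (0, Pi.single i 1)

lemma m2_fd_smooth : ContDiff ℝ (⊤ : ℕ∞) (fderiv ℝ (m2 Γ)) :=
  (m2_smooth Γ).fderiv_right (by exact le_of_eq rfl)

lemma V_smooth (i : Fin d) : ContDiff ℝ (⊤ : ℕ∞) (V Γ i) :=
  ((m2_fd_smooth Γ).comp (contDiff_id.prodMk contDiff_const)).clm_apply contDiff_const

lemma m2_diff (p) : HasFDerivAt (m2 Γ) (fderiv ℝ (m2 Γ) p) p :=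
  ((m2_smooth Γ).differentiable (by simp) p).hasFDerivAt

lemma hasDeriv_single (i : Fin d) (t : ℝ) :
    HasDerivAt (fun t : ℝ => (Pi.single i t : Gc d)) (Pi.single i 1) t := by
  have : (fun t : ℝ => (Pi.single i t : Gc d)) = fun t => t • (Pi.single i 1 : Gc d) := by
    funext t; rw [← Pi.single_smul]; simp
  rw [this]
  simpa using (hasDerivAt_id t).smul_const (Pi.single i 1 : Gc d)

lemma V_deriv (i : Fin d) (y : Gc d) :
    HasDerivAt (fun t : ℝ => Γ.mul y (Pi.single i t)) (V Γ i y) 0 := by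
  have h1 : HasDerivAt (fun t : ℝ => (y, (Pi.single i t : Gc d))) (0, Pi.single i 1) 0 :=
    (hasDerivAt_const _ _).prodMk (hasDeriv_single i 0)
  have h2 := (m2_diff Γ (y, 0))
  have h0 : (y, (0 : Gc d)) = (fun t : ℝ => (y, (Pi.single i t : Gc d))) 0 := by simp
  rw [h0] at h2
  have := h2.comp_hasDerivAt (0:ℝ) h1
  simp only [Pi.single_zero] at this
  exact this

lemma V_zero (i : Fin d) : V Γ i 0 = Pi.single i 1 := by
  have h := V_deriv Γ i 0
  simp only [zmul] at h
  exact h.unique (hasDeriv_single i 0)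

lemma fdiff {f : Gc d → ℝ} (hf : ContDiff ℝ (⊤ : ℕ∞) f) (y) :
    HasFDerivAt f (fderiv ℝ f y) y := (hf.differentiable (by simp) y).hasFDerivAt

lemma X_eq {f : Gc d → ℝ} (hf : ContDiff ℝ (⊤ : ℕ∞) f) (i : Fin d) (y : Gc d) :
    Γ.X i f y = fderiv ℝ f y (V Γ i y) := by
  have h2 := fdiff hf y
  have h0 : y = (fun t : ℝ => Γ.mul y (Pi.single i t)) 0 := by simp [mulz]
  rw [h0] at h2
  have := h2.comp_hasDerivAt (0:ℝ) (V_deriv Γ i y)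
  simp only [Pi.single_zero, mulz] at this
  exact this.deriv

lemma fd_smooth {f : Gc d → ℝ} (hf : ContDiff ℝ (⊤ : ℕ∞) f) :
    ContDiff ℝ (⊤ : ℕ∞) (fderiv ℝ f) := hf.fderiv_right (by exact le_of_eq rfl)

lemma X_smooth {f : Gc d → ℝ} (hf : ContDiff ℝ (⊤ : ℕ∞) f) (i : Fin d) :
    ContDiff ℝ (⊤ : ℕ∞) (Γ.X i f) := by
  have : Γ.X i f = fun y => fderiv ℝ f y (V Γ i y) := funext (X_eq Γ hf i)
  rw [this]
  exact (fd_smooth hf).clm_apply (V_smooth Γ i)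

lemma X_L (f : Gc d → ℝ) (x : Gc d) (i : Fin d) :
    Γ.X i (fun y => f (Γ.mul x y)) = fun y => Γ.X i f (Γ.mul x y) := by
  funext y; simp only [HLG.X, Γ.mul_assoc']

lemma X_dil (f : Gc d → ℝ) {r : ℝ} (hr : 0 < r) (i : Fin d) :
    Γ.X i (fun y => f (Γ.dil r y)) = fun y => r ^ Γ.s i * Γ.X i f (Γ.dil r y) := by
  funext y
  simp only [HLG.X, dilmul Γ hr, dilsingle]
  have := deriv_comp_mul_left (r ^ Γ.s i) (fun t => f (Γ.mul (Γ.dil r y) (Pi.single i t))) 0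
  simpa using this

lemma V_dil {r : ℝ} (hr : 0 < r) (i k : Fin d) (y : Gc d) :
    r ^ Γ.s k * V Γ i y k = r ^ Γ.s i * V Γ i (Γ.dil r y) k := by
  have hp : ∀ y, Γ.X i (fun z => z k) y = V Γ i y k := fun y => by
    have := (hasDerivAt_pi.1 (V_deriv Γ i y) k).deriv
    exact this
  have h := congrFun (X_dil Γ (fun z => z k) hr i) y
  simp only [hp] at h
  rw [← h]
  simp only [HLG.X, HLG.dil]
  rw [deriv_const_mul_field, (hasDerivAt_pi.1 (V_deriv Γ i y) k).deriv]

/-- structure constants -/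
def cc (i j k : Fin d) : ℝ :=
  fderiv ℝ (V Γ j) 0 (Pi.single i 1) k - fderiv ℝ (V Γ i) 0 (Pi.single j 1) k

lemma DV_hom (i j k : Fin d) (h : fderiv ℝ (V Γ j) 0 (Pi.single i 1) k ≠ 0) :
    Γ.s k = Γ.s i + Γ.s j := by
  have hd : HasDerivAt (fun t : ℝ => V Γ j (Pi.single i t) k)
      (fderiv ℝ (V Γ j) 0 (Pi.single i 1) k) 0 := by
    have h2 : HasFDerivAt (V Γ j) (fderiv ℝ (V Γ j) 0) ((fun t : ℝ => (Pi.single i t : Gc d)) 0) := by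
      simpa using ((V_smooth Γ j).differentiable (by simp) 0).hasFDerivAt
    exact hasDerivAt_pi.1 (h2.comp_hasDerivAt (0:ℝ) (hasDeriv_single i 0)) k
  have key := fun t => V_dil Γ (two_pos) j k (Pi.single i t)
  simp only [dilsingle] at key
  have h1 := (hd.const_mul ((2:ℝ) ^ Γ.s k)).deriv
  have h3 := deriv_comp_mul_left ((2:ℝ) ^ Γ.s i) (fun t : ℝ => V Γ j (Pi.single i t) k) 0
  rw [mul_zero, hd.deriv] at h3
  simp only [key] at h1
  rw [deriv_const_mul_field, h3, smul_eq_mul, ← mul_assoc] at h1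
  have h4 := mul_right_cancel₀ h h1
  rw [← Real.rpow_add two_pos] at h4
  have := (Real.rpow_right_inj two_pos (by norm_num : (2:ℝ) ≠ 1)).1 h4
  linarith

lemma cc_hom (i j k : Fin d) (h : cc Γ i j k ≠ 0) : Γ.s k = Γ.s i + Γ.s j := by
  by_cases h1 : fderiv ℝ (V Γ j) 0 (Pi.single i 1) k = 0
  · have : fderiv ℝ (V Γ i) 0 (Pi.single j 1) k ≠ 0 := by
      intro h2; apply h; rw [cc, h1, h2, sub_zero]
    rw [DV_hom Γ j i k this, add_comm]
  · exact DV_hom Γ i j k h1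

lemma clm_sum (T : Gc d →L[ℝ] ℝ) (v : Gc d) : T v = ∑ k, v k * T (Pi.single k 1) := by
  conv_lhs => rw [pi_eq_sum_univ' v]
  rw [map_sum]
  refine Finset.sum_congr rfl fun k _ => ?_
  rw [map_smul, smul_eq_mul]

lemma comm0 {f : Gc d → ℝ} (hf : ContDiff ℝ (⊤ : ℕ∞) f) (i j : Fin d) :
    Γ.X i (Γ.X j f) 0 - Γ.X j (Γ.X i f) 0 = ∑ k, cc Γ i j k * Γ.X k f 0 := by
  have hX : ∀ i j, Γ.X i (Γ.X j f) 0 = fderiv ℝ (fderiv ℝ f) 0 (Pi.single i 1) (Pi.single j 1)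
      + fderiv ℝ f 0 (fderiv ℝ (V Γ j) 0 (Pi.single i 1)) := by
    intro i j
    rw [X_eq Γ (X_smooth Γ hf j)]
    have h1 : Γ.X j f = fun y => fderiv ℝ f y (V Γ j y) := funext (X_eq Γ hf j)
    have h2 : HasFDerivAt (fderiv ℝ f) (fderiv ℝ (fderiv ℝ f) 0) 0 :=
      ((fd_smooth hf).differentiable (by simp) 0).hasFDerivAt
    have h3 : HasFDerivAt (V Γ j) (fderiv ℝ (V Γ j) 0) 0 :=
      ((V_smooth Γ j).differentiable (by simp) 0).hasFDerivAt
    rw [h1, (h2.clm_apply h3).fderiv, V_zero]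
    simp [V_zero, add_comm]
  have hsym : fderiv ℝ (fderiv ℝ f) 0 (Pi.single i 1) (Pi.single j 1)
      = fderiv ℝ (fderiv ℝ f) 0 (Pi.single j 1) (Pi.single i 1) := by
    have : IsSymmSndFDerivAt ℝ f 0 := hf.contDiffAt.isSymmSndFDerivAt
      (by simp only [minSmoothness_of_isRCLikeNormedField]; exact WithTop.coe_le_coe.2 le_top)
    exact this _ _
  rw [hX, hX, hsym, add_sub_add_left_eq_sub, ← map_sub, clm_sum]
  refine Finset.sum_congr rfl fun k _ => ?_
  rw [X_eq Γ hf, V_zero]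
  rfl

lemma comm {f : Gc d → ℝ} (hf : ContDiff ℝ (⊤ : ℕ∞) f) (i j : Fin d) (y : Gc d) :
    Γ.X i (Γ.X j f) y - Γ.X j (Γ.X i f) y = ∑ k, cc Γ i j k * Γ.X k f y := by
  have := comm0 Γ (f := fun z => f (Γ.mul y z)) (hf.comp (L_smooth Γ y)) i j
  simpa only [X_L, X_L Γ (Γ.X _ f), mulz] using this

/-- the space of smooth functions -/
def S (d : ℕ) : Submodule ℝ (Gc d → ℝ) where
  carrier := {f | ContDiff ℝ (⊤ : ℕ∞) f}
  add_mem' := fun {f g} (hf : ContDiff ℝ (⊤ : ℕ∞) f) (hg : ContDiff ℝ (⊤ : ℕ∞) g) => hf.add hg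
  zero_mem' := (contDiff_const : ContDiff ℝ (⊤ : ℕ∞) (fun _ : Gc d => (0:ℝ)))
  smul_mem' := fun c f (hf : ContDiff ℝ (⊤ : ℕ∞) f) => hf.const_smul c

/-- `X_i` as an endomorphism of smooth functions -/
def XS (i : Fin d) : Module.End ℝ (S d) where
  toFun f := ⟨Γ.X i f.1, X_smooth Γ f.2 i⟩
  map_add' f g := by
    apply Subtype.ext; funext y
    have h1 := X_eq Γ f.2 i y
    have h2 := X_eq Γ g.2 i y
    have h3 := X_eq Γ (f + g).2 i y
    have h4 := ((fdiff f.2 y).add (fdiff g.2 y)).fderiv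
    change Γ.X i (f + g).1 y = Γ.X i f.1 y + Γ.X i g.1 y
    rw [h1, h2, h3, ← add_apply, ← h4]
    rfl
  map_smul' c f := by
    apply Subtype.ext; funext y
    have h1 := X_eq Γ f.2 i y
    have h3 := X_eq Γ (c • f).2 i y
    have h4 := ((fdiff f.2 y).const_smul c).fderiv
    change Γ.X i (c • f).1 y = c • Γ.X i f.1 y
    rw [h1, h3, ← smul_apply, ← h4]
    rfl

/-- word operator -/
def W (w : List (Fin d)) : Module.End ℝ (S d) := (w.map (XS Γ)).prod

/-- ordered monomial operator -/
def M (I : Fin d → ℕ) : Module.End ℝ (S d) :=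
  ((List.finRange d).map fun j => XS Γ j ^ I j).prod

lemma pow_val (i : Fin d) (n : ℕ) (f : S d) : ((XS Γ i ^ n) f).1 = (Γ.X i)^[n] f.1 := by
  induction n with
  | zero => rfl
  | succ n ih =>
    rw [pow_succ', Module.End.mul_apply, Function.iterate_succ_apply', ← ih]; rfl

lemma M_val (I : Fin d → ℕ) (f : S d) : (M Γ I f).1 = Γ.XI I f.1 := by
  unfold M HLG.XI
  generalize List.finRange d = l
  induction l with
  | nil => rfl
  | cons j l ih =>
    simp only [List.map_cons, List.prod_cons, List.foldr_cons, Module.End.mul_apply,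
      Function.comp_apply]
    rw [← ih, pow_val]

lemma XI_smooth (I : Fin d → ℕ) {f : Gc d → ℝ} (hf : ContDiff ℝ (⊤ : ℕ∞) f) :
    ContDiff ℝ (⊤ : ℕ∞) (Γ.XI I f) := by
  have := (M Γ I ⟨f, hf⟩).2
  rw [M_val] at this
  exact this

/-- the canonical ordered word -/
def can (I : Fin d → ℕ) : List (Fin d) :=
  (List.finRange d).flatMap fun j => List.replicate (I j) j

lemma W_can (I : Fin d → ℕ) : W Γ (can I) = M Γ I := by
  unfold W M can
  generalize List.finRange d = l
  induction l with
  | nil => rfl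
  | cons j l ih =>
    simp only [List.flatMap_cons, List.map_append, List.prod_append, ih, List.map_cons,
      List.prod_cons, List.map_replicate, List.prod_replicate]

lemma count_can (I : Fin d → ℕ) (j : Fin d) : (can I).count j = I j := by
  unfold can
  rw [List.count_flatMap, ← List.ofFn_eq_map, List.sum_ofFn]
  simp [List.count_replicate]

lemma can_perm (w : List (Fin d)) : w.Perm (can fun j => w.count j) := by
  rw [List.perm_iff_count]
  intro j; rw [count_can]

/-- degree of a word -/
def deg (w : List (Fin d)) : ℝ := (w.map Γ.s).sum

lemma deg_count (w : List (Fin d)) : Γ.dI (fun j => w.count j) = deg Γ w := by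
  unfold HLG.dI deg
  induction w with
  | nil => simp
  | cons i w ih =>
    simp only [List.count_cons, List.map_cons, List.sum_cons, ← ih]
    push_cast
    simp [mul_add, Finset.sum_add_distrib, add_comm]

lemma len_count (w : List (Fin d)) : absI (fun j => w.count j) = w.length := by
  unfold absI
  induction w with
  | nil => simp
  | cons i w ih =>
    simp only [List.count_cons, List.length_cons, ← ih]
    simp [Finset.sum_add_distrib]

/-- span of words of length `< n` with degree `δ` -/
def WW (n : ℕ) (δ : ℝ) : Submodule ℝ (Module.End ℝ (S d)) :=
  Submodule.span ℝ (W Γ '' {w | w.length < n ∧ deg Γ w = δ})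

lemma W_cons (i : Fin d) (w) : W Γ (i :: w) = XS Γ i * W Γ w := by simp [W]
lemma deg_cons (i : Fin d) (w) : deg Γ (i :: w) = Γ.s i + deg Γ w := by simp [deg]

lemma deg_perm {w w' : List (Fin d)} (h : w.Perm w') : deg Γ w = deg Γ w' :=
  (h.map _).sum_eq

lemma WW_cons (i : Fin d) (n : ℕ) (δ : ℝ) (T) (hT : T ∈ WW Γ n δ) :
    XS Γ i * T ∈ WW Γ (n + 1) (Γ.s i + δ) := by
  unfold WW at hT
  induction hT using Submodule.span_induction with
  | mem x hx =>
    obtain ⟨w, hw, rfl⟩ := hx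
    apply Submodule.subset_span
    refine ⟨i :: w, ⟨?_, ?_⟩, W_cons Γ i w⟩
    · simpa using hw.1
    · rw [deg_cons, hw.2]
  | zero => simp
  | add x y _ _ hx hy => rw [mul_add]; exact add_mem hx hy
  | smul c x _ hx => rw [mul_smul_comm]; exact Submodule.smul_mem _ _ hx

lemma XS_comm (i j : Fin d) :
    XS Γ i * XS Γ j = XS Γ j * XS Γ i + ∑ k, cc Γ i j k • XS Γ k := by
  ext f
  rename_i y
  have := comm Γ f.2 i j y
  simp only [LinearMap.add_apply, LinearMap.sum_apply, LinearMap.smul_apply]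
  rw [Submodule.coe_add, Submodule.coe_sum, Pi.add_apply, Finset.sum_apply, add_comm]
  exact sub_eq_iff_eq_add.1 this

lemma perm_mod {w w' : List (Fin d)} (h : w.Perm w') :
    ∃ T ∈ WW Γ w.length (deg Γ w), W Γ w = W Γ w' + T := by
  induction h with
  | nil => exact ⟨0, zero_mem _, by rw [add_zero]⟩
  | cons i _ ih =>
    obtain ⟨T, hT, h⟩ := ih
    refine ⟨XS Γ i * T, ?_, by rw [W_cons, W_cons, h, mul_add]⟩
    rw [deg_cons]
    exact WW_cons Γ i _ _ _ hT
  | swap i j l =>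
    refine ⟨∑ k, cc Γ j i k • W Γ (k :: l), ?_, ?_⟩
    · refine Submodule.sum_mem _ fun k _ => ?_
      by_cases hc : cc Γ j i k = 0
      · rw [hc, zero_smul]; exact zero_mem _
      · refine Submodule.smul_mem _ _ (Submodule.subset_span ⟨k :: l, ⟨by simp, ?_⟩, rfl⟩)
        simp only [deg_cons]
        rw [cc_hom Γ j i k hc]; ring
    · simp only [W_cons]
      rw [← mul_assoc, ← mul_assoc, XS_comm, add_mul, Finset.sum_mul]
      simp only [smul_mul_assoc]
  | trans h1 h2 ih1 ih2 =>
    rw [← h1.length_eq, ← deg_perm Γ h1] at ih2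
    obtain ⟨T, hT, h⟩ := ih1
    obtain ⟨T', hT', h'⟩ := ih2
    exact ⟨T' + T, add_mem hT' hT, by rw [h, h', add_assoc]⟩

/-- span of ordered monomials -/
def MM (n : ℕ) (δ : ℝ) : Submodule ℝ (Module.End ℝ (S d)) :=
  Submodule.span ℝ (M Γ '' {I | absI I ≤ n ∧ Γ.dI I = δ})

lemma pbw (n : ℕ) : ∀ w : List (Fin d), w.length ≤ n → W Γ w ∈ MM Γ n (deg Γ w) := by
  induction n with
  | zero =>
    intro w hw
    have : w = [] := by simpa using hw
    subst this
    apply Submodule.subset_span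
    refine ⟨fun j => List.count j [], ⟨by rw [len_count]; exact hw, deg_count Γ _⟩, ?_⟩
    simp [M, W]
  | succ n ih =>
    intro w hw
    obtain ⟨T, h1, hT⟩ := perm_mod Γ (can_perm w)
    rw [W_can] at hT
    have h2 : WW Γ w.length (deg Γ w) ≤ MM Γ (n + 1) (deg Γ w) := by
      unfold WW
      rw [Submodule.span_le]
      rintro _ ⟨u, ⟨hu, hd⟩, rfl⟩
      have h3 := ih u (by omega)
      rw [hd] at h3
      refine Submodule.span_mono (image_mono ?_) h3
      intro I hI
      exact ⟨hI.1.trans (by omega), hI.2⟩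
    have h4 : M Γ (fun j => w.count j) ∈ MM Γ (n + 1) (deg Γ w) :=
      Submodule.subset_span ⟨_, ⟨by rw [len_count]; exact hw, deg_count Γ w⟩, rfl⟩
    rw [hT]
    exact add_mem h4 (h2 h1)

lemma mem_multi (n : ℕ) (I : Fin d → ℕ) : I ∈ multiIdxLe d n ↔ absI I ≤ n := by
  unfold multiIdxLe absI
  simp only [Finset.mem_filter, Finset.mem_image, Finset.mem_univ, true_and]
  refine ⟨fun h => h.2, fun h => ⟨⟨fun j => ⟨I j, ?_⟩, rfl⟩, h⟩⟩
  have := Finset.single_le_sum (f := I) (fun i _ => Nat.zero_le _) (Finset.mem_univ j)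
  omega

lemma X_XI (N : ℕ) (k : Fin d) (I : Fin d → ℕ) (hI : absI I < N) :
    ∃ c : (Fin d → ℕ) → ℝ,
      (∀ J, c J ≠ 0 → absI J ≤ absI I + 1 ∧ Γ.dI J = Γ.s k + Γ.dI I) ∧
      ∀ f : Gc d → ℝ, ContDiff ℝ (⊤ : ℕ∞) f → ∀ y,
        Γ.X k (Γ.XI I f) y = ∑ J ∈ multiIdxLe d N, c J * Γ.XI J f y := by
  have hc : (fun j => (can I).count j) = I := funext (count_can I)
  have hl : (can I).length = absI I := by rw [← len_count, hc]
  have hdg : deg Γ (can I) = Γ.dI I := by rw [← deg_count, hc]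
  have h := pbw Γ (absI I + 1) (k :: can I) (by simp [hl])
  unfold MM at h
  rw [Finsupp.mem_span_image_iff_linearCombination] at h
  obtain ⟨l, hl1, hl2⟩ := h
  rw [Finsupp.mem_supported] at hl1
  rw [W_cons, W_can] at hl2
  rw [deg_cons, hdg] at hl1
  refine ⟨l, fun J hJ => hl1 (by simpa using hJ), fun f hf y => ?_⟩
  have h1 : ((XS Γ k * M Γ I) ⟨f, hf⟩ : S d).1 y = Γ.X k (Γ.XI I f) y := by
    rw [← M_val Γ I ⟨f, hf⟩]; rfl
  rw [← h1, ← hl2, Finsupp.linearCombination_apply,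
    Finsupp.sum_of_support_subset (s := multiIdxLe d N)]
  · simp only [LinearMap.sum_apply, LinearMap.smul_apply]
    rw [Submodule.coe_sum, Finset.sum_apply]
    refine Finset.sum_congr rfl fun J _ => ?_
    rw [← M_val Γ J ⟨f, hf⟩]; rfl
  · intro J hJ
    rw [mem_multi]
    have := (hl1 hJ).1
    omega
  · simp

lemma XI_add_smul (I : Fin d → ℕ) {f g : Gc d → ℝ} (hf : ContDiff ℝ (⊤ : ℕ∞) f)
    (hg : ContDiff ℝ (⊤ : ℕ∞) g) (y : Gc d) :
    Γ.XI I (fun z => f z - g z) y = Γ.XI I f y - Γ.XI I g y := by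
  have h := map_sub (M Γ I) ⟨f, hf⟩ ⟨g, hg⟩
  have h1 := congrFun (congrArg Subtype.val h) y
  rw [AddSubgroupClass.coe_sub, M_val, M_val, M_val] at h1
  exact h1

lemma XI_L (I : Fin d → ℕ) (f : Gc d → ℝ) (x y : Gc d) :
    Γ.XI I (fun z => f (Γ.mul x z)) y = Γ.XI I f (Γ.mul x y) := by
  have hit : ∀ (j : Fin d) (n : ℕ) (g : Gc d → ℝ), (Γ.X j)^[n] (fun z => g (Γ.mul x z))
      = fun z => (Γ.X j)^[n] g (Γ.mul x z) := by
    intro j n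
    induction n with
    | zero => intro g; rfl
    | succ n ih => intro g; rw [Function.iterate_succ_apply, X_L, ih]; rfl
  have : Γ.XI I (fun z => f (Γ.mul x z)) = fun y => Γ.XI I f (Γ.mul x y) := by
    unfold HLG.XI
    generalize List.finRange d = l
    induction l with
    | nil => rfl
    | cons j l ih =>
      simp only [List.map_cons, List.foldr_cons, Function.comp_apply]
      rw [ih, hit]
  exact congrFun this y

lemma XI_dil (I : Fin d → ℕ) (f : S d) {r : ℝ} (hr : 0 < r) (F : S d)
    (hF : F.1 = fun z => f.1 (Γ.dil r z)) (y : Gc d) :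
    Γ.XI I F.1 y = r ^ Γ.dI I * Γ.XI I f.1 (Γ.dil r y) := by
  have hW : ∀ w : List (Fin d), (W Γ w F).1 = fun y => r ^ deg Γ w * (W Γ w f).1 (Γ.dil r y) := by
    intro w
    induction w with
    | nil => simp [W, deg, hF]
    | cons i w ih =>
      rw [W_cons]
      have h1 : ((XS Γ i * W Γ w) F).1 = Γ.X i (W Γ w F).1 := rfl
      have h2 : ((XS Γ i * W Γ w) f).1 = Γ.X i (W Γ w f).1 := rfl
      rw [h1, h2, ih, deg_cons]
      have h3 := X_dil Γ (W Γ w f).1 hr i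
      funext y
      have h4 := congrFun h3 y
      rw [Real.rpow_add hr, mul_assoc, mul_left_comm, ← h4]
      simp only [HLG.X]
      rw [deriv_const_mul_field]
  have hc : (fun j => (can I).count j) = I := funext (count_can I)
  have hdg : deg Γ (can I) = Γ.dI I := by rw [← deg_count, hc]
  have := congrFun (hW (can I)) y
  rwa [W_can, M_val, M_val, hdg] at this

lemma eta_smooth (J : Fin d → ℕ) : ContDiff ℝ (⊤ : ℕ∞) (etaI J) := by
  unfold etaI
  exact contDiff_prod fun j _ => (contDiff_apply ℝ ℝ j).pow _

lemma eta_dil (J : Fin d → ℕ) {r : ℝ} (hr : 0 < r) (z : Gc d) :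
    etaI J (Γ.dil r z) = r ^ Γ.dI J * etaI J z := by
  unfold etaI HLG.dil HLG.dI
  rw [Real.rpow_sum_of_pos hr, ← Finset.prod_mul_distrib]
  refine Finset.prod_congr rfl fun j _ => ?_
  rw [mul_pow, Real.rpow_mul hr.le, Real.rpow_natCast]

lemma XI_eta (I J : Fin d → ℕ) (h : Γ.dI J < Γ.dI I) (y : Gc d) :
    Γ.XI I (etaI J) y = 0 := by
  set f : S d := ⟨etaI J, eta_smooth J⟩
  have key : ∀ r : ℝ, 0 < r → Γ.XI I (etaI J) y
      = r ^ (Γ.dI I - Γ.dI J) * Γ.XI I (etaI J) (Γ.dil r y) := by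
    intro r hr
    have h1 := XI_dil Γ I f hr (r ^ Γ.dI J • f) (by
      funext z; exact (eta_dil Γ J hr z).symm) y
    rw [← M_val, map_smul] at h1
    have h2 : (r ^ Γ.dI J • M Γ I f).1 y = r ^ Γ.dI J * Γ.XI I (etaI J) y := by
      rw [← M_val Γ I f]; rfl
    rw [h2] at h1
    rw [Real.rpow_sub hr, div_mul_eq_mul_div]
    rw [eq_div_iff (Real.rpow_pos_of_pos hr _).ne', mul_comm]
    exact h1
  have hc : Continuous fun r : ℝ => r ^ (Γ.dI I - Γ.dI J) * Γ.XI I (etaI J) (Γ.dil r y) := by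
    refine (Real.continuous_rpow_const (by linarith)).mul
      ((XI_smooth Γ I (eta_smooth J)).continuous.comp ?_)
    refine continuous_pi fun j => ?_
    exact (Real.continuous_rpow_const (by linarith [Γ.one_le_s j])).mul continuous_const
  have h1 := (hc.tendsto 0).mono_left (nhdsWithin_le_nhds (s := Ioi 0))
  rw [Real.zero_rpow (by linarith), zero_mul] at h1
  have h2 : Filter.Tendsto (fun r : ℝ => r ^ (Γ.dI I - Γ.dI J) * Γ.XI I (etaI J) (Γ.dil r y))
      (nhdsWithin 0 (Ioi 0)) (nhds (Γ.XI I (etaI J) y)) := by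
    refine tendsto_const_nhds.congr' ?_
    filter_upwards [self_mem_nhdsWithin] with r hr using key r hr
  exact tendsto_nhds_unique h2 h1

lemma poly_smooth (c : (Fin d → ℕ) →₀ ℝ) : ContDiff ℝ (⊤ : ℕ∞) (polyFun c) := by
  unfold polyFun Finsupp.sum
  exact ContDiff.sum fun J _ => contDiff_const.mul (eta_smooth J)

lemma XI_poly (I : Fin d → ℕ) (a : ℝ) (c : (Fin d → ℕ) →₀ ℝ) (hc : ∀ J ∈ c.support, Γ.dI J < a)
    (hI : a ≤ Γ.dI I) (y : Gc d) : Γ.XI I (polyFun c) y = 0 := by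
  have h : (⟨polyFun c, poly_smooth c⟩ : S d)
      = ∑ J ∈ c.support, c J • (⟨etaI J, eta_smooth J⟩ : S d) := by
    apply Subtype.ext
    rw [Submodule.coe_sum]
    funext z
    rw [Finset.sum_apply]
    rfl
  rw [← M_val Γ I ⟨polyFun c, poly_smooth c⟩, h, map_sum, Submodule.coe_sum, Finset.sum_apply]
  refine Finset.sum_eq_zero fun J hJ => ?_
  rw [map_smul]
  have h2 : (c J • M Γ I (⟨etaI J, eta_smooth J⟩ : S d)).1 y = c J * Γ.XI I (etaI J) y := by
    rw [← M_val Γ I ⟨etaI J, eta_smooth J⟩]; rfl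
  rw [h2, XI_eta Γ I J (lt_of_lt_of_le (hc J hJ) hI), mul_zero]

/-- coefficient of `X_k` along the ray -/
def bb (k : Fin d) (t : ℝ) (y : Gc d) : ℝ :=
  fderiv ℝ (m2 Γ) (Γ.inv (t • y), t • y) (0, y) k

lemma bb_cont (k : Fin d) : Continuous fun p : ℝ × Gc d => bb Γ k p.1 p.2 := by
  unfold bb
  have h1 : Continuous fun p : ℝ × Gc d => (Γ.inv (p.1 • p.2), p.1 • p.2) := by
    have h2 : Continuous fun p : ℝ × Gc d => p.1 • p.2 := by fun_prop
    exact (Γ.smooth_inv.continuous.comp h2).prodMk h2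
  have h3 : Continuous fun p : ℝ × Gc d =>
      fderiv ℝ (m2 Γ) (Γ.inv (p.1 • p.2), p.1 • p.2) (0, p.2) :=
    ((m2_fd_smooth Γ).continuous.comp h1).clm_apply (by fun_prop)
  exact (continuous_apply k).comp h3

lemma bb_deriv (t : ℝ) (y : Gc d) :
    HasDerivAt (fun s : ℝ => Γ.mul (Γ.inv (t • y)) (s • y)) (fun k => bb Γ k t y) t := by
  have h1 : HasDerivAt (fun s : ℝ => (Γ.inv (t • y), s • y)) (0, y) t := by
    refine (hasDerivAt_const _ _).prodMk ?_
    simpa using (hasDerivAt_id t).smul_const y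
  exact (m2_diff Γ (Γ.inv (t • y), t • y)).comp_hasDerivAt t h1

lemma bb_hom (k : Fin d) (r : ℝ) (hr : 0 < r) (t : ℝ) (y : Gc d) :
    bb Γ k t (Γ.dil r y) = r ^ Γ.s k * bb Γ k t y := by
  have h1 := (hasDerivAt_pi.1 (bb_deriv Γ t (Γ.dil r y)) k).deriv
  have h2 := (hasDerivAt_pi.1 (bb_deriv Γ t y) k).deriv
  rw [← h1, ← h2]
  simp only [← dilsmul, ← dilinv Γ hr, ← dilmul Γ hr]
  simp only [HLG.dil]
  rw [deriv_const_mul_field]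

lemma line_deriv {g : Gc d → ℝ} (hg : ContDiff ℝ (⊤ : ℕ∞) g) (y : Gc d) (t : ℝ) :
    HasDerivAt (fun s : ℝ => g (s • y)) (∑ k, bb Γ k t y * Γ.X k g (t • y)) t := by
  set z := t • y with hz
  have hG : ContDiff ℝ (⊤ : ℕ∞) fun w => g (Γ.mul z w) := hg.comp (L_smooth Γ z)
  have h1 := bb_deriv Γ t y
  rw [← hz] at h1
  have h2 := fdiff hG (Γ.mul (Γ.inv z) (t • y))
  have h3 := h2.comp_hasDerivAt t h1
  have h4 : (fun w => g (Γ.mul z w)) ∘ (fun s : ℝ => Γ.mul (Γ.inv z) (s • y))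
      = fun s : ℝ => g (s • y) := by
    funext s; simp only [Function.comp_apply, mulinvmul]
  rw [h4, ← hz, invmul, clm_sum] at h3
  have h6 : ∀ k, Γ.X k g z = fderiv ℝ (fun w => g (Γ.mul z w)) 0 (Pi.single k 1) := fun k => by
    have h5 := X_eq Γ hG k 0
    rw [V_zero, X_L] at h5
    beta_reduce at h5
    rwa [mulz] at h5
  simp only [h6]
  exact h3

lemma line_int {g : Gc d → ℝ} (hg : ContDiff ℝ (⊤ : ℕ∞) g) (h0 : g 0 = 0) (y : Gc d) (t : ℝ) :
    g (t • y) = ∑ k, ∫ s in (0:ℝ)..t, bb Γ k s y * Γ.X k g (s • y) := by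
  have hc : ∀ k, Continuous fun s : ℝ => bb Γ k s y * Γ.X k g (s • y) := fun k =>
    ((bb_cont Γ k).comp (continuous_id.prodMk continuous_const)).mul
      ((X_smooth Γ hg k).continuous.comp (by fun_prop))
  have hs : Continuous fun s : ℝ => ∑ k, bb Γ k s y * Γ.X k g (s • y) :=
    continuous_finsetSum _ fun k _ => hc k
  rw [← intervalIntegral.integral_finsetSum fun k _ => (hc k).intervalIntegrable _ _,
    intervalIntegral.integral_eq_sub_of_hasDerivAt (fun s _ => line_deriv Γ hg y s)
      (hs.intervalIntegrable _ _)]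
  simp [h0]

/-- densities with the correct bound -/
def Den (δ : ℝ) (q : ℝ → Gc d → ℝ) : Prop :=
  (∀ y, Continuous fun ρ => q ρ y) ∧
    ∃ C : ℝ, 0 ≤ C ∧ ∀ y, ∀ ρ ∈ Icc (0:ℝ) 1, |q ρ y| ≤ C * Γ.hnorm y ^ δ

lemma Den_zero (δ : ℝ) : Den Γ δ fun _ _ => 0 :=
  ⟨fun _ => continuous_const, 0, le_rfl, by simp⟩

lemma Den_add {δ : ℝ} {q q' : ℝ → Gc d → ℝ} (h : Den Γ δ q) (h' : Den Γ δ q') :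
    Den Γ δ fun ρ y => q ρ y + q' ρ y := by
  obtain ⟨hc, C, hC, hb⟩ := h
  obtain ⟨hc', C', hC', hb'⟩ := h'
  refine ⟨fun y => (hc y).add (hc' y), C + C', by positivity, fun y ρ hρ => ?_⟩
  refine (abs_add_le _ _).trans ?_
  rw [add_mul]
  exact add_le_add (hb y ρ hρ) (hb' y ρ hρ)

lemma Den_smul {δ : ℝ} {q : ℝ → Gc d → ℝ} (c : ℝ) (h : Den Γ δ q) :
    Den Γ δ fun ρ y => c * q ρ y := by
  obtain ⟨hc, C, hC, hb⟩ := h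
  refine ⟨fun y => continuous_const.mul (hc y), |c| * C, by positivity, fun y ρ hρ => ?_⟩
  rw [abs_mul, mul_assoc]
  exact mul_le_mul_of_nonneg_left (hb y ρ hρ) (abs_nonneg c)

lemma Den_sum {ι : Type*} (s : Finset ι) {δ : ℝ} {q : ι → ℝ → Gc d → ℝ}
    (h : ∀ i ∈ s, Den Γ δ (q i)) : Den Γ δ fun ρ y => ∑ i ∈ s, q i ρ y := by
  induction s using Finset.induction_on with
  | empty => simpa using Den_zero Γ δ
  | insert i s hi ih =>
    simp only [Finset.sum_insert hi]
    exact Den_add Γ (h i (by simp)) (ih fun j hj => h j (by simp [hj]))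

lemma Den_bb (k : Fin d) : Den Γ (Γ.s k) (bb Γ k) := by
  refine ⟨fun y => (bb_cont Γ k).comp (continuous_id.prodMk continuous_const), ?_⟩
  exact hom_bound Γ (fun p => bb Γ k p.1 p.2) (bb_cont Γ k) (Γ.s k)
    (by linarith [Γ.one_le_s k]) (fun r hr t y => bb_hom Γ k r hr t y)

/-- next density -/
def nxt (k : Fin d) (q : ℝ → Gc d → ℝ) (ρ : ℝ) (y : Gc d) : ℝ :=
  bb Γ k ρ y * ∫ σ in ρ..1, q σ y

lemma cont_int {q : ℝ → ℝ} (hq : Continuous q) : Continuous fun ρ => ∫ σ in ρ..(1:ℝ), q σ := by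
  have : (fun ρ => ∫ σ in ρ..(1:ℝ), q σ) = fun ρ => - ∫ σ in (1:ℝ)..ρ, q σ := by
    funext ρ; rw [intervalIntegral.integral_symm]
  rw [this]
  exact (intervalIntegral.continuous_primitive (fun a b => hq.intervalIntegrable a b) 1).neg

lemma Den_nxt (k : Fin d) {δ : ℝ} (hδ : 0 ≤ δ) {q : ℝ → Gc d → ℝ} (h : Den Γ δ q) :
    Den Γ (Γ.s k + δ) (nxt Γ k q) := by
  obtain ⟨hc, C, hC, hb⟩ := h
  obtain ⟨hc', C', hC', hb'⟩ := Den_bb Γ k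
  refine ⟨fun y => (hc' y).mul (cont_int (hc y)), C' * C, by positivity, fun y ρ hρ => ?_⟩
  have hn := Γ.hnorm_nonneg y
  have h1 : |∫ σ in ρ..1, q σ y| ≤ C * Γ.hnorm y ^ δ := by
    have := intervalIntegral.norm_integral_le_of_norm_le_const (a := ρ) (b := 1)
      (f := fun σ => q σ y) (C := C * Γ.hnorm y ^ δ) (fun σ hσ => by
        rw [uIoc_of_le hρ.2] at hσ
        exact hb y σ ⟨hρ.1.trans hσ.1.le, hσ.2⟩)
    rw [Real.norm_eq_abs] at this
    refine this.trans ?_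
    have h2 : |1 - ρ| ≤ 1 := by rw [abs_of_nonneg (by linarith [hρ.2])]; linarith [hρ.1]
    have h3 : 0 ≤ C * Γ.hnorm y ^ δ := by positivity
    nlinarith
  unfold nxt
  rw [abs_mul, Real.rpow_add_of_nonneg hn (by linarith [Γ.one_le_s k]) hδ]
  calc _ ≤ (C' * Γ.hnorm y ^ Γ.s k) * (C * Γ.hnorm y ^ δ) := by
        gcongr; exact hb' y ρ hρ
    _ = _ := by ring

lemma by_parts {q u : ℝ → ℝ} (hq : Continuous q) (hu : Continuous u) :
    ∫ ρ in (0:ℝ)..1, q ρ * ∫ σ in (0:ℝ)..ρ, u σ = ∫ σ in (0:ℝ)..1, u σ * ∫ ρ in σ..1, q ρ := by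
  have h := intervalIntegral.integral_mul_deriv_eq_deriv_mul (a := 0) (b := 1)
    (u := fun ρ => ∫ σ in (0:ℝ)..ρ, u σ) (v := fun ρ => ∫ σ in (1:ℝ)..ρ, q σ) (u' := u) (v' := q)
    (fun x _ => hu.integral_hasStrictDerivAt 0 x |>.hasDerivAt)
    (fun x _ => hq.integral_hasStrictDerivAt 1 x |>.hasDerivAt)
    (hu.intervalIntegrable _ _) (hq.intervalIntegrable _ _)
  simp only [intervalIntegral.integral_same, mul_zero, zero_mul, sub_zero, zero_sub] at h
  rw [← intervalIntegral.integral_neg] at h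
  calc _ = ∫ ρ in (0:ℝ)..1, (∫ σ in (0:ℝ)..ρ, u σ) * q ρ := by simp only [mul_comm]
    _ = _ := h
    _ = _ := by
      refine intervalIntegral.integral_congr fun σ _ => ?_
      beta_reduce
      rw [intervalIntegral.integral_symm, mul_neg, neg_neg]

lemma step {h : Gc d → ℝ} (hh : ContDiff ℝ (⊤ : ℕ∞) h) (h0 : h 0 = 0) (y : Gc d)
    {q : ℝ → Gc d → ℝ} (hq : Continuous fun ρ => q ρ y) :
    ∫ ρ in (0:ℝ)..1, q ρ y * h (ρ • y)
      = ∑ k, ∫ ρ in (0:ℝ)..1, nxt Γ k q ρ y * Γ.X k h (ρ • y) := by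
  have hc : ∀ k, Continuous fun s : ℝ => bb Γ k s y * Γ.X k h (s • y) := fun k =>
    ((bb_cont Γ k).comp (continuous_id.prodMk continuous_const)).mul
      ((X_smooth Γ hh k).continuous.comp (by fun_prop))
  have h1 : ∀ ρ : ℝ, q ρ y * h (ρ • y)
      = ∑ k, q ρ y * ∫ s in (0:ℝ)..ρ, bb Γ k s y * Γ.X k h (s • y) := fun ρ => by
    rw [line_int Γ hh h0, Finset.mul_sum]
  simp only [h1]
  have hp : ∀ k, Continuous fun ρ : ℝ =>
      q ρ y * ∫ s in (0:ℝ)..ρ, bb Γ k s y * Γ.X k h (s • y) := fun k =>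
    hq.mul (intervalIntegral.continuous_primitive
      (fun a b => (hc k).intervalIntegrable a b) 0)
  rw [intervalIntegral.integral_finsetSum fun k _ => (hp k).intervalIntegrable _ _]
  refine Finset.sum_congr rfl fun k _ => ?_
  rw [by_parts hq (hc k)]
  refine intervalIntegral.integral_congr fun σ _ => ?_
  simp only [nxt]; ring

lemma dI_nonneg (I : Fin d → ℕ) : 0 ≤ Γ.dI I :=
  Finset.sum_nonneg fun j _ => mul_nonneg (by linarith [Γ.one_le_s j]) (Nat.cast_nonneg _)

lemma XI_zero (f : S d) : Γ.XI 0 f.1 = f.1 := by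
  rw [← M_val]; simp [M]

/-- The main induction: expansion along the ray. -/
lemma main (a : ℝ) (ha : 0 < a) (N n : ℕ) (hn : n + 1 ≤ N) :
    ∃ q : (Fin d → ℕ) → ℝ → Gc d → ℝ, (∀ I, Den Γ (Γ.dI I) (q I)) ∧
      (∀ I, ¬ (absI I ≤ n + 1 ∧ ((n + 1 : ℝ) ≤ Γ.dI I ∨ a ≤ Γ.dI I)) → q I = fun _ _ => 0) ∧
      ∀ g : Gc d → ℝ, ContDiff ℝ (⊤ : ℕ∞) g → (∀ I, Γ.dI I < a → Γ.XI I g 0 = 0) → ∀ y,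
        g y = ∑ I ∈ multiIdxLe d N, ∫ ρ in (0:ℝ)..1, q I ρ y * Γ.XI I g (ρ • y) := by
  -- expansions of `X_k X^I`
  have hex : ∀ (k : Fin d) (I : Fin d → ℕ), ∃ c : (Fin d → ℕ) → ℝ,
      (∀ J, c J ≠ 0 → absI J ≤ absI I + 1 ∧ Γ.dI J = Γ.s k + Γ.dI I) ∧
      (absI I < N → ∀ f : Gc d → ℝ, ContDiff ℝ (⊤ : ℕ∞) f → ∀ y,
        Γ.X k (Γ.XI I f) y = ∑ J ∈ multiIdxLe d N, c J * Γ.XI J f y) := by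
    intro k I
    by_cases hI : absI I < N
    · obtain ⟨c, h1, h2⟩ := X_XI Γ N k I hI
      exact ⟨c, h1, fun _ => h2⟩
    · exact ⟨fun _ => 0, by simp, fun h => absurd h hI⟩
  choose c hc1 hc2 using hex
  have hXc : ∀ {g : Gc d → ℝ}, ContDiff ℝ (⊤ : ℕ∞) g → ∀ (J : Fin d → ℕ) (y : Gc d),
      Continuous fun ρ : ℝ => Γ.XI J g (ρ • y) := fun hg J y =>
    (XI_smooth Γ J hg).continuous.comp (by fun_prop)
  induction n with
  | zero =>
    have habs0 : absI (0 : Fin d → ℕ) = 0 := by simp [absI]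
    have hd0 : Γ.dI (0 : Fin d → ℕ) = 0 := by simp [HLG.dI]
    refine ⟨fun J ρ y => ∑ k, c k 0 J * bb Γ k ρ y, ?_, ?_, ?_⟩
    · intro J
      refine Den_sum Γ _ fun k _ => ?_
      by_cases h : c k 0 J = 0
      · simpa [h] using Den_zero Γ _
      · have := (hc1 k 0 J h).2
        rw [hd0, add_zero] at this
        rw [this]
        exact Den_smul Γ _ (Den_bb Γ k)
    · intro J hJ
      funext ρ y
      refine Finset.sum_eq_zero fun k _ => ?_
      by_cases h : c k 0 J = 0
      · rw [h, zero_mul]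
      · exfalso; apply hJ
        have := hc1 k 0 J h
        rw [hd0, habs0] at this
        refine ⟨this.1, Or.inl ?_⟩
        rw [this.2]; have := Γ.one_le_s k; push_cast; linarith
    · intro g hg hg0 y
      have h0 : g 0 = 0 := by
        have := hg0 0 (by rw [hd0]; exact ha)
        rwa [XI_zero Γ ⟨g, hg⟩] at this
      have h1 := line_int Γ hg h0 y 1
      rw [one_smul] at h1
      rw [h1]
      have h2 : ∀ k (s : ℝ), bb Γ k s y * Γ.X k g (s • y)
          = ∑ J ∈ multiIdxLe d N, c k 0 J * bb Γ k s y * Γ.XI J g (s • y) := fun k s => by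
        have := hc2 k 0 (by omega) g hg (s • y)
        rw [XI_zero Γ ⟨g, hg⟩] at this
        simp only at this
        rw [this, Finset.mul_sum]
        exact Finset.sum_congr rfl fun J _ => by ring
      have hcc : ∀ k J, Continuous fun s : ℝ => c k 0 J * bb Γ k s y * Γ.XI J g (s • y) :=
        fun k J => (continuous_const.mul ((Den_bb Γ k).1 y)).mul (hXc hg J y)
      simp only [h2]
      simp only [Finset.sum_mul]
      rw [Finset.sum_congr rfl fun k _ => intervalIntegral.integral_finsetSum fun J _ =>
        (hcc k J).intervalIntegrable _ _, Finset.sum_comm]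
      refine Finset.sum_congr rfl fun J _ => ?_
      rw [intervalIntegral.integral_finsetSum fun k _ => (hcc k J).intervalIntegrable _ _]
  | succ n ih =>
    obtain ⟨q, hq1, hq2, hq3⟩ := ih (by omega)
    have hDen : ∀ J I k, Den Γ (Γ.dI J)
        (fun ρ y => if Γ.dI I < a then c k I J * nxt Γ k (q I) ρ y else 0) := by
      intro J I k
      by_cases hI : Γ.dI I < a
      · simp only [hI, if_true]
        by_cases h : c k I J = 0
        · simpa [h] using Den_zero Γ _
        · rw [(hc1 k I J h).2]
          exact Den_smul Γ _ (Den_nxt Γ k (dI_nonneg Γ I) (hq1 I))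
      · simpa only [hI, if_false] using Den_zero Γ _
    have hDen0 : ∀ J, Den Γ (Γ.dI J) (fun ρ y => if a ≤ Γ.dI J then q J ρ y else 0) := by
      intro J
      by_cases hJ : a ≤ Γ.dI J
      · simpa only [hJ, if_true] using hq1 J
      · simpa only [hJ, if_false] using Den_zero Γ _
    refine ⟨fun J ρ y => (if a ≤ Γ.dI J then q J ρ y else 0) +
      ∑ I ∈ multiIdxLe d N, ∑ k, if Γ.dI I < a then c k I J * nxt Γ k (q I) ρ y else 0,
      ?_, ?_, ?_⟩
    · intro J
      exact Den_add Γ (hDen0 J) (Den_sum Γ _ fun I _ => Den_sum Γ _ fun k _ => hDen J I k)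
    · intro J hJ
      funext ρ y
      have h1 : (if a ≤ Γ.dI J then q J ρ y else 0) = 0 := by
        split_ifs with h
        · rw [hq2 J]
          rintro ⟨h2, -⟩
          exact hJ ⟨by omega, Or.inr h⟩
        · rfl
      beta_reduce
      rw [h1, zero_add]
      refine Finset.sum_eq_zero fun I _ => Finset.sum_eq_zero fun k _ => ?_
      split_ifs with hI
      · by_cases h : c k I J = 0
        · rw [h, zero_mul]
        · by_cases h3 : absI I ≤ n + 1 ∧ ((n + 1 : ℝ) ≤ Γ.dI I ∨ a ≤ Γ.dI I)
          · exfalso; apply hJ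
            have h4 := hc1 k I J h
            have h5 : (n + 1 : ℝ) ≤ Γ.dI I := h3.2.resolve_right (not_le.2 hI)
            refine ⟨by omega, Or.inl ?_⟩
            rw [h4.2]; have := Γ.one_le_s k; push_cast; linarith
          · simp [nxt, hq2 I h3]
      · rfl
    · intro g hg hg0 y
      have hterm : ∀ I ∈ multiIdxLe d N, ∫ ρ in (0:ℝ)..1, q I ρ y * Γ.XI I g (ρ • y)
          = (∫ ρ in (0:ℝ)..1, (if a ≤ Γ.dI I then q I ρ y else 0) * Γ.XI I g (ρ • y)) +
            ∑ J ∈ multiIdxLe d N, ∑ k, ∫ ρ in (0:ℝ)..1,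
              (if Γ.dI I < a then c k I J * nxt Γ k (q I) ρ y else 0) * Γ.XI J g (ρ • y) := by
        intro I _
        by_cases hI : a ≤ Γ.dI I
        · simp [hI, not_lt.2 hI]
        · have hI' := not_le.1 hI
          simp only [hI, hI', if_true, if_false, zero_mul, intervalIntegral.integral_zero, zero_add]
          by_cases h3 : absI I ≤ n + 1 ∧ ((n + 1 : ℝ) ≤ Γ.dI I ∨ a ≤ Γ.dI I)
          · rw [step Γ (XI_smooth Γ I hg) (hg0 I hI') y ((hq1 I).1 y), Finset.sum_comm]
            refine Finset.sum_congr rfl fun k _ => ?_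
            have hp : ∀ J, Continuous fun ρ : ℝ =>
                c k I J * nxt Γ k (q I) ρ y * Γ.XI J g (ρ • y) := fun J =>
              (continuous_const.mul ((Den_nxt Γ k (dI_nonneg Γ I) (hq1 I)).1 y)).mul
                (hXc hg J y)
            rw [← intervalIntegral.integral_finsetSum fun J _ => (hp J).intervalIntegrable _ _]
            refine intervalIntegral.integral_congr fun ρ _ => ?_
            beta_reduce
            rw [hc2 k I (by omega) g hg, Finset.mul_sum]
            exact Finset.sum_congr rfl fun J _ => by ring
          · simp [nxt, hq2 I h3]
      rw [hq3 g hg hg0 y, Finset.sum_congr rfl hterm, Finset.sum_add_distrib, Finset.sum_comm,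
        ← Finset.sum_add_distrib]
      refine Finset.sum_congr rfl fun J _ => ?_
      simp only [add_mul, Finset.sum_mul]
      have hcI : ∀ I k, Continuous fun ρ : ℝ =>
          (if Γ.dI I < a then c k I J * nxt Γ k (q I) ρ y else 0) * Γ.XI J g (ρ • y) :=
        fun I k => ((hDen J I k).1 y).mul (hXc hg J y)
      have hcS : ∀ I, Continuous fun ρ : ℝ =>
          ∑ k, (if Γ.dI I < a then c k I J * nxt Γ k (q I) ρ y else 0) * Γ.XI J g (ρ • y) :=
        fun I => continuous_finsetSum _ fun k _ => hcI I k
      have hcT : Continuous fun ρ : ℝ => ∑ I ∈ multiIdxLe d N,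
          ∑ k, (if Γ.dI I < a then c k I J * nxt Γ k (q I) ρ y else 0) * Γ.XI J g (ρ • y) :=
        continuous_finsetSum _ fun I _ => hcS I
      have hc0 : Continuous fun ρ : ℝ =>
          (if a ≤ Γ.dI J then q J ρ y else 0) * Γ.XI J g (ρ • y) :=
        ((hDen0 J).1 y).mul (hXc hg J y)
      rw [intervalIntegral.integral_add (hc0.intervalIntegrable _ _) (hcT.intervalIntegrable _ _),
        intervalIntegral.integral_finsetSum fun I _ => (hcS I).intervalIntegrable _ _]
      congr 1
      refine Finset.sum_congr rfl fun I _ => ?_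
      rw [intervalIntegral.integral_finsetSum fun k _ => (hcI I k).intervalIntegrable _ _]

/-- measure on the segment `[0,y]` with density `q` -/
def meas (q : ℝ → ℝ) (y : Gc d) : Measure (Gc d) :=
  ((volume.restrict (Icc (0:ℝ) 1)).withDensity fun ρ => ENNReal.ofReal (q ρ)).map
    fun ρ : ℝ => ρ • y

lemma ray_meas (y : Gc d) : Measurable fun ρ : ℝ => ρ • y :=
  (by fun_prop : Continuous fun ρ : ℝ => ρ • y).measurable

lemma meas_univ (q : ℝ → ℝ) (y : Gc d) (B : ℝ) (hB : ∀ ρ ∈ Icc (0:ℝ) 1, q ρ ≤ B) :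
    meas q y univ ≤ ENNReal.ofReal B := by
  unfold meas
  rw [Measure.map_apply (ray_meas y) MeasurableSet.univ, preimage_univ, withDensity_apply _ MeasurableSet.univ,
    Measure.restrict_univ]
  calc _ ≤ ∫⁻ ρ in Icc (0:ℝ) 1, ENNReal.ofReal B :=
        setLIntegral_mono measurable_const fun ρ hρ => ENNReal.ofReal_le_ofReal (hB ρ hρ)
    _ = _ := by simp

lemma meas_supp (q : ℝ → ℝ) (y : Gc d) (s : Set (Gc d)) (hs : MeasurableSet s)
    (h : ∀ ρ ∈ Icc (0:ℝ) 1, ρ • y ∉ s) : meas q y s = 0 := by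
  unfold meas
  rw [Measure.map_apply (ray_meas y) hs]
  apply withDensity_absolutelyContinuous
  rw [Measure.restrict_apply (ray_meas y hs)]
  convert measure_empty (μ := (volume : Measure ℝ))
  ext ρ
  simp only [mem_inter_iff, mem_preimage, mem_empty_iff_false, iff_false, not_and]
  exact fun h1 h2 => h ρ h2 h1

lemma meas_int {q : ℝ → ℝ} (hq : Continuous q) (y : Gc d) {h : Gc d → ℝ} (hh : Continuous h) :
    ∫ z, h z ∂(meas q y) = ∫ ρ in (0:ℝ)..1, max (q ρ) 0 * h (ρ • y) := by
  unfold meas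
  rw [integral_map (ray_meas y).aemeasurable hh.aestronglyMeasurable,
    integral_withDensity_eq_integral_toReal_smul (by fun_prop) (by simp),
    intervalIntegral.integral_of_le zero_le_one, integral_Icc_eq_integral_Ioc]
  simp [ENNReal.toReal_ofReal']

lemma meas_diff {q : ℝ → ℝ} (hq : Continuous q) (y : Gc d) {h : Gc d → ℝ} (hh : Continuous h) :
    (∫ z, h z ∂(meas q y)) - ∫ z, h z ∂(meas (fun ρ => - q ρ) y)
      = ∫ ρ in (0:ℝ)..1, q ρ * h (ρ • y) := by
  rw [meas_int hq y hh, meas_int (q := fun ρ => - q ρ) hq.neg y hh, ← intervalIntegral.integral_sub]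
  · refine intervalIntegral.integral_congr fun ρ _ => ?_
    beta_reduce
    rw [← sub_mul, max_zero_sub_max_neg_zero_eq_self]
  · exact Continuous.intervalIntegrable (by fun_prop) _ _
  · exact Continuous.intervalIntegrable (by fun_prop) _ _

lemma meas_zero (y : Gc d) : meas (fun _ => 0) y = 0 := by
  unfold meas; simp

end TT
end HomLie

namespace HomLie
open HLG

/-- **Taylor's theorem on homogeneous Lie groups with explicit remainder measures.**
For each `a > 0` there is `β > 0` (depending only on the group) and, for each multi-index
`I` with `|I| ≤ [a]+1` and `d(I) ≥ a` and each `y`, a finite signed measure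
`Q^I(y,·) = Qp I y - Qm I y` supported in `B_{β^{[a]+1}|y|}(e)` with total variation
`≲ |y|^{d(I)}`, such that for every smooth `f` and all `x, y`:
`f(xy) − P^a_x[f](y) = Σ_{|I| ≤ [a]+1, d(I) ≥ a} ∫ X^I f(xz) Q^I(y,dz)`. -/
theorem taylor_theorem (d : ℕ) (Γ : HLG d) (a : ℝ) (ha : 0 < a) :
    ∃ β : ℝ, 0 < β ∧
    ∃ Qp Qm : (Fin d → ℕ) → Gc d → MeasureTheory.Measure (Gc d), ∃ C : (Fin d → ℕ) → ℝ,
      (∀ I y, MeasureTheory.IsFiniteMeasure (Qp I y) ∧ MeasureTheory.IsFiniteMeasure (Qm I y)) ∧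
      (∀ I y, Qp I y {z | β ^ (Nat.floor a + 1) * Γ.hnorm y < Γ.hnorm z} = 0 ∧
              Qm I y {z | β ^ (Nat.floor a + 1) * Γ.hnorm y < Γ.hnorm z} = 0) ∧
      (∀ I y, Qp I y Set.univ + Qm I y Set.univ ≤
        ENNReal.ofReal (C I * Γ.hnorm y ^ Γ.dI I)) ∧
      (∀ I : Fin d → ℕ, ¬ (absI I ≤ Nat.floor a + 1 ∧ a ≤ Γ.dI I) →
        ∀ y, Qp I y = 0 ∧ Qm I y = 0) ∧
      (∀ f : Gc d → ℝ, ContDiff ℝ (⊤ : ℕ∞) f → ∀ x y : Gc d, ∀ P : Gc d → ℝ,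
        IsTaylorAt Γ a f x P →
        f (Γ.mul x y) - P y =
          ∑ I ∈ multiIdxLe d (Nat.floor a + 1),
            ((∫ z, Γ.XI I f (Γ.mul x z) ∂(Qp I y)) -
              ∫ z, Γ.XI I f (Γ.mul x z) ∂(Qm I y))) := by
  have hN : Nat.floor a + 1 ≤ Nat.floor a + 1 := le_rfl
  obtain ⟨q, hq1, hq2, hq3⟩ := TT.main Γ a ha (Nat.floor a + 1) (Nat.floor a) hN
  have hq0 : ∀ I : Fin d → ℕ, ¬ (absI I ≤ Nat.floor a + 1 ∧ a ≤ Γ.dI I) →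
      q I = fun _ _ => 0 := by
    intro I hI
    refine hq2 I fun h => hI ⟨h.1, h.2.elim (fun h2 => ?_) id⟩
    exact (Nat.lt_floor_add_one a).le.trans h2
  obtain ⟨B, hB0, hB⟩ := TT.hom_bound Γ (fun p => Γ.hnorm (p.1 • p.2))
    (Γ.hnorm_cont.comp (by fun_prop)) 1 one_pos (fun r hr t y => by
      simp only
      rw [← TT.dilsmul, Real.rpow_one]
      exact Γ.hnorm_dil r hr _)
  choose hqc C hC0 hCb using hq1
  set β : ℝ := max B 1 with hβ
  have hβ1 : 1 ≤ β := le_max_right _ _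
  have hlt : ∀ I y, TT.meas (fun ρ => q I ρ y) y Set.univ
      ≤ ENNReal.ofReal (C I * Γ.hnorm y ^ Γ.dI I) := fun I y =>
    TT.meas_univ _ _ _ fun ρ hρ => (le_abs_self _).trans (hCb I y ρ hρ)
  have hlt' : ∀ I y, TT.meas (fun ρ => - q I ρ y) y Set.univ
      ≤ ENNReal.ofReal (C I * Γ.hnorm y ^ Γ.dI I) := fun I y =>
    TT.meas_univ _ _ _ fun ρ hρ => (neg_le_abs _).trans (hCb I y ρ hρ)
  have hsupp : ∀ y, ∀ ρ ∈ Icc (0:ℝ) 1,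
      ρ • y ∉ {z | β ^ (Nat.floor a + 1) * Γ.hnorm y < Γ.hnorm z} := by
    intro y ρ hρ
    have h1 := hB y ρ hρ
    rw [Real.rpow_one] at h1
    have h2 : B ≤ β ^ (Nat.floor a + 1) :=
      (le_max_left _ _).trans (le_self_pow₀ hβ1 (Nat.succ_ne_zero _))
    simp only [mem_ofPred_eq, not_lt]
    exact ((le_abs_self _).trans h1).trans (mul_le_mul_of_nonneg_right h2 (Γ.hnorm_nonneg y))
  have hms : ∀ y, MeasurableSet {z | β ^ (Nat.floor a + 1) * Γ.hnorm y < Γ.hnorm z} := fun y =>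
    (isOpen_lt continuous_const Γ.hnorm_cont).measurableSet
  refine ⟨β, by linarith, fun I y => TT.meas (fun ρ => q I ρ y) y,
    fun I y => TT.meas (fun ρ => - q I ρ y) y, fun I => 2 * C I, ?_, ?_, ?_, ?_, ?_⟩
  · intro I y
    exact ⟨⟨(hlt I y).trans_lt ENNReal.ofReal_lt_top⟩, ⟨(hlt' I y).trans_lt ENNReal.ofReal_lt_top⟩⟩
  · intro I y
    exact ⟨TT.meas_supp _ _ _ (hms y) (hsupp y), TT.meas_supp _ _ _ (hms y) (hsupp y)⟩
  · intro I y
    have h0 : 0 ≤ C I * Γ.hnorm y ^ Γ.dI I :=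
      mul_nonneg (hC0 I) (Real.rpow_nonneg (Γ.hnorm_nonneg y) _)
    refine (add_le_add (hlt I y) (hlt' I y)).trans ?_
    rw [← ENNReal.ofReal_add h0 h0]
    apply ENNReal.ofReal_le_ofReal
    linarith
  · intro I hI y
    simp only [hq0 I hI, neg_zero, TT.meas_zero, and_self]
  · rintro f hf x y P ⟨⟨c, hc, rfl⟩, hT⟩
    have hfx : ContDiff ℝ (⊤ : ℕ∞) fun z => f (Γ.mul x z) := hf.comp (TT.L_smooth Γ x)
    have hP := TT.poly_smooth c
    have h1 := hq3 (fun z => f (Γ.mul x z) - polyFun c z) (hfx.sub hP) (fun I hI => by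
      have h2 := hT I hI
      rw [TT.one0] at h2
      rw [TT.XI_add_smul Γ I hfx hP, TT.XI_L, TT.mulz, h2, sub_self]) y
    beta_reduce at h1
    rw [h1]
    refine Finset.sum_congr rfl fun I _ => ?_
    rw [TT.meas_diff (hqc I y) y (h := fun z => Γ.XI I f (Γ.mul x z))
      ((TT.XI_smooth Γ I hf).continuous.comp (TT.L_smooth Γ x).continuous)]
    refine intervalIntegral.integral_congr fun ρ _ => ?_
    beta_reduce
    by_cases hI : absI I ≤ Nat.floor a + 1 ∧ a ≤ Γ.dI I
    · rw [TT.XI_add_smul Γ I hfx hP, TT.XI_L, TT.XI_poly Γ I a c hc hI.2, sub_zero]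
    · rw [hq0 I hI, zero_mul, zero_mul]

end HomLie
end
end

section
/- Coefficient bound for homogeneous polynomials from pointwise derivative bounds: Let 𝔾 be a homogeneous Lie group, δ > 0, and let P be an element of the polynomial structure space of homogeneous degree < δ, i.e. a linear combination P = Σ_{d(I)<δ} a_I 𝛈^I of abstract monomials, with concrete realisation p := Π_e P = Σ_{d(I)<δ} a_I η^I. If for some ε ∈ [0,1] one has |(X^I p)(e)| ≤ ε^{δ−d(I)} for every multi-index I with d(I) < δ, then for every a ≤ δ the degree-a component satisfies |P|_a ≲_{δ,𝔾} ε^{δ−a} (where |·|_a is a fixed norm on the finite-dimensional span of the 𝛈^I with d(I) = a). -/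
open Set
noncomputable section
attribute [local instance] Classical.propDecidable

namespace HomLie
open HLG

variable {d : ℕ}

/-- The norm of the degree-`a` component of an abstract polynomial: the sum of the
absolute values of the coefficients of the monomials `𝛈^I` with `d(I) = a`. -/
def gradeNormC (Γ : HLG d) (c : (Fin d → ℕ) →₀ ℝ) (a : ℝ) : ℝ :=
  ∑ I ∈ c.support.filter fun I => Γ.dI I = a, |c I|

/-- Smoothness predicate. -/
def Sm (f : Gc d → ℝ) : Prop := ContDiff ℝ (⊤ : ℕ∞) f

lemma single_smooth (i : Fin d) : ContDiff ℝ (⊤ : ℕ∞) (fun t : ℝ => (Pi.single i t : Gc d)) :=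
  (ContinuousLinearMap.single ℝ (fun _ : Fin d => ℝ) i).contDiff

lemma curve_smooth (Γ : HLG d) (i : Fin d) (y : Gc d) :
    ContDiff ℝ (⊤ : ℕ∞) (fun t : ℝ => Γ.mul y (Pi.single i t)) :=
  Γ.smooth_mul.comp (contDiff_const.prodMk (single_smooth i))

lemma curve_diff (Γ : HLG d) (i : Fin d) (y : Gc d) {f : Gc d → ℝ} (hf : Sm f) (t : ℝ) :
    DifferentiableAt ℝ (fun t : ℝ => f (Γ.mul y (Pi.single i t))) t :=
  ((ContDiff.comp hf (curve_smooth Γ i y)).differentiable (by simp)) t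

lemma one_zero (Γ : HLG d) : Γ.one = 0 := Γ.one_eq_zero

lemma curve_zero (Γ : HLG d) (i : Fin d) (y : Gc d) :
    Γ.mul y (Pi.single i 0) = y := by
  rw [Pi.single_zero, ← one_zero Γ, Γ.mul_one']

lemma X_smooth (Γ : HLG d) (i : Fin d) {f : Gc d → ℝ} (hf : Sm f) : Sm (Γ.X i f) := by
  have hF : ContDiff ℝ (⊤ : ℕ∞) (fun p : Gc d × Gc d => f (Γ.mul p.1 p.2)) :=
    ContDiff.comp hf Γ.smooth_mul
  have key : Γ.X i f = fun y => fderiv ℝ (fun p : Gc d × Gc d => f (Γ.mul p.1 p.2)) (y, 0)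
      (0, Pi.single i 1) := by
    funext y
    have h1 : HasDerivAt (fun t : ℝ => ((y, Pi.single i t) : Gc d × Gc d))
        ((0, Pi.single i 1) : Gc d × Gc d) 0 := by
      refine (hasDerivAt_const _ _).prodMk ?_
      exact (ContinuousLinearMap.single ℝ (fun _ : Fin d => ℝ) i).hasDerivAt
    have h2 : HasFDerivAt (fun p : Gc d × Gc d => f (Γ.mul p.1 p.2))
        (fderiv ℝ (fun p : Gc d × Gc d => f (Γ.mul p.1 p.2)) (y, 0))
        ((y, Pi.single i (0 : ℝ)) : Gc d × Gc d) := by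
      rw [Pi.single_zero]
      exact ((hF.differentiable (by simp)) _).hasFDerivAt
    exact (h2.comp_hasDerivAt (0 : ℝ) h1).deriv
  rw [key]
  have h3 : ContDiff ℝ (⊤ : ℕ∞)
      (fderiv ℝ (fun p : Gc d × Gc d => f (Γ.mul p.1 p.2))) :=
    hF.fderiv_right (by simp)
  exact (h3.comp (contDiff_id.prodMk contDiff_const)).clm_apply contDiff_const

lemma X_add (Γ : HLG d) (i : Fin d) {f g : Gc d → ℝ} (hf : Sm f) (hg : Sm g) :
    Γ.X i (f + g) = Γ.X i f + Γ.X i g := by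
  funext y
  exact deriv_add (curve_diff Γ i y hf 0) (curve_diff Γ i y hg 0)

lemma X_smul (Γ : HLG d) (i : Fin d) (a : ℝ) (f : Gc d → ℝ) :
    Γ.X i (a • f) = a • Γ.X i f := by
  funext y
  exact deriv_const_mul_field a

lemma X_mul (Γ : HLG d) (i : Fin d) {f g : Gc d → ℝ} (hf : Sm f) (hg : Sm g) :
    Γ.X i (f * g) = Γ.X i f * g + f * Γ.X i g := by
  funext y
  have := deriv_mul (curve_diff Γ i y hf 0) (curve_diff Γ i y hg 0)
  simp only [curve_zero] at this
  exact this

lemma Sm.add {f g : Gc d → ℝ} (hf : Sm f) (hg : Sm g) : Sm (f + g) := ContDiff.add hf hg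
lemma Sm.mul {f g : Gc d → ℝ} (hf : Sm f) (hg : Sm g) : Sm (f * g) := ContDiff.mul hf hg
lemma Sm.smul {f : Gc d → ℝ} (a : ℝ) (hf : Sm f) : Sm (a • f) := ContDiff.const_smul a hf

lemma etaI_smooth (J : Fin d → ℕ) : Sm (etaI J) := by
  unfold Sm etaI
  fun_prop

/-- Functions vanishing to order `k` at the identity. -/
def Van (Γ : HLG d) : ℕ → (Gc d → ℝ) → Prop
  | 0, f => Sm f
  | k + 1, f => Sm f ∧ f Γ.one = 0 ∧ ∀ i, Van Γ k (Γ.X i f)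

lemma Van.sm {Γ : HLG d} {k : ℕ} {f : Gc d → ℝ} (h : Van Γ k f) : Sm f := by
  cases k with
  | zero => exact h
  | succ k => exact h.1

lemma Van.pred {Γ : HLG d} {k : ℕ} : ∀ {f : Gc d → ℝ}, Van Γ (k + 1) f → Van Γ k f := by
  induction k with
  | zero => intro f h; exact h.1
  | succ k ih => intro f h; exact ⟨h.1, h.2.1, fun i => ih (h.2.2 i)⟩

lemma Van.one {Γ : HLG d} {f : Gc d → ℝ} (h : Sm f) (h0 : f Γ.one = 0) : Van Γ 1 f :=
  ⟨h, h0, fun i => X_smooth Γ i h⟩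

lemma Van.add {Γ : HLG d} {k : ℕ} : ∀ {f g : Gc d → ℝ}, Van Γ k f → Van Γ k g →
    Van Γ k (f + g) := by
  induction k with
  | zero => intro f g hf hg; exact Sm.add hf hg
  | succ k ih =>
    intro f g hf hg
    refine ⟨hf.1.add hg.1, by simp [hf.2.1, hg.2.1], fun i => ?_⟩
    rw [X_add Γ i hf.1 hg.1]
    exact ih (hf.2.2 i) (hg.2.2 i)

lemma Van.smul {Γ : HLG d} {k : ℕ} (a : ℝ) : ∀ {f : Gc d → ℝ}, Van Γ k f →
    Van Γ k (a • f) := by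
  induction k with
  | zero => intro f hf; exact Sm.smul a hf
  | succ k ih =>
    intro f hf
    refine ⟨hf.1.smul a, by simp [hf.2.1], fun i => ?_⟩
    rw [X_smul]
    exact ih (hf.2.2 i)

lemma zero_sm : Sm (0 : Gc d → ℝ) :=
  (contDiff_const : ContDiff ℝ (⊤ : ℕ∞) fun _ : Gc d => (0 : ℝ))

lemma one_sm : Sm (1 : Gc d → ℝ) :=
  (contDiff_const : ContDiff ℝ (⊤ : ℕ∞) fun _ : Gc d => (1 : ℝ))

lemma Van.zero (Γ : HLG d) (k : ℕ) : Van Γ k 0 := by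
  induction k with
  | zero => exact zero_sm
  | succ k ih =>
    refine ⟨zero_sm, rfl, fun i => ?_⟩
    have : Γ.X i 0 = 0 := by simpa using X_smul Γ i 0 0
    rw [this]; exact ih

lemma Van.sum {Γ : HLG d} {k : ℕ} {ι : Type*} (s : Finset ι) (f : ι → Gc d → ℝ)
    (h : ∀ j ∈ s, Van Γ k (f j)) : Van Γ k (∑ j ∈ s, f j) := by
  induction s using Finset.induction_on with
  | empty => simpa using Van.zero Γ k
  | insert a s ha ih =>
    rw [Finset.sum_insert ha]
    exact (h a (by simp)).add (ih fun j hj => h j (by simp [hj]))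

lemma Van.mul_aux (Γ : HLG d) (n : ℕ) : ∀ (a b : ℕ), a + b = n → ∀ f g : Gc d → ℝ,
    Van Γ a f → Van Γ b g → Van Γ n (f * g) := by
  induction n with
  | zero => intro a b _ f g hf hg; exact hf.sm.mul hg.sm
  | succ n ih =>
    intro a b hab f g hf hg
    refine ⟨hf.sm.mul hg.sm, ?_, fun i => ?_⟩
    · cases a with
      | succ a => simp [hf.2.1]
      | zero =>
        obtain rfl : b = n + 1 := by omega
        simp [hg.2.1]
    · rw [X_mul Γ i hf.sm hg.sm]
      refine Van.add ?_ ?_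
      · cases a with
        | succ a => exact ih a b (by omega) _ _ (hf.2.2 i) hg
        | zero =>
          obtain rfl : b = n + 1 := by omega
          exact ih 0 n (by omega) _ _ (X_smooth Γ i hf) hg.pred
      · cases b with
        | succ b => exact ih a b (by omega) _ _ hf (hg.2.2 i)
        | zero =>
          obtain rfl : a = n + 1 := by omega
          exact ih n 0 (by omega) _ _ hf.pred (X_smooth Γ i hg)

lemma Van.mul {Γ : HLG d} {a b : ℕ} {f g : Gc d → ℝ} (hf : Van Γ a f) (hg : Van Γ b g) :
    Van Γ (a + b) (f * g) := Van.mul_aux Γ _ a b rfl f g hf hg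

/-- Coordinate function. -/
def co (j : Fin d) : Gc d → ℝ := fun x => x j

lemma co_smooth (j : Fin d) : Sm (co j) := by
  unfold Sm co
  fun_prop

lemma co_van (Γ : HLG d) (j : Fin d) : Van Γ 1 (co j) :=
  Van.one (co_smooth j) (by simp [co, one_zero])

lemma pow_van (Γ : HLG d) (j : Fin d) (n : ℕ) : Van Γ n (co j ^ n) := by
  induction n with
  | zero => rw [pow_zero]; exact one_sm
  | succ n ih => rw [pow_succ]; exact ih.mul (co_van Γ j)

lemma prod_van (Γ : HLG d) (J : Fin d → ℕ) (s : Finset (Fin d)) :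
    Van Γ (∑ j ∈ s, J j) (∏ j ∈ s, co j ^ J j) := by
  induction s using Finset.induction_on with
  | empty => rw [Finset.sum_empty, Finset.prod_empty]; exact one_sm
  | insert a s ha ih =>
    rw [Finset.prod_insert ha, Finset.sum_insert ha]
    exact (pow_van Γ a _).mul ih

lemma eta_van (Γ : HLG d) (J : Fin d → ℕ) : Van Γ (absI J) (etaI J) := by
  have : etaI J = ∏ j, (co j : Gc d → ℝ) ^ J j := by
    funext x; simp [etaI, co, Finset.prod_apply]
  rw [this]; exact prod_van Γ J _

lemma X_co_one (Γ : HLG d) (i k : Fin d) :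
    Γ.X i (co k) Γ.one = (Pi.single i (1 : ℝ) : Gc d) k := by
  unfold HLG.X co
  simp only [Γ.one_mul']
  have := (ContinuousLinearMap.single ℝ (fun _ : Fin d => ℝ) i).hasDerivAt (x := (0 : ℝ))
  rw [hasDerivAt_pi] at this
  exact (this k).deriv

lemma eta_sub (J : Fin d → ℕ) (k : Fin d) (x : Gc d) :
    etaI (J - Pi.single k 1) x = (∏ j ∈ Finset.univ.erase k, x j ^ J j) * x k ^ (J k - 1) := by
  unfold etaI
  rw [← Finset.prod_erase_mul _ _ (Finset.mem_univ k)]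
  congr 1
  · refine Finset.prod_congr rfl fun j hj => ?_
    rw [Finset.mem_erase] at hj
    simp [Pi.single_apply, hj.1]
  · simp

lemma X_eta (Γ : HLG d) (i : Fin d) (J : Fin d → ℕ) :
    Γ.X i (etaI J) = ∑ k, (J k : ℝ) • (etaI (J - Pi.single k 1) * Γ.X i (co k)) := by
  funext y
  have h : ∀ k ∈ (Finset.univ : Finset (Fin d)),
      HasDerivAt (fun t : ℝ => (Γ.mul y (Pi.single i t)) k ^ J k)
      ((J k : ℝ) * y k ^ (J k - 1) * Γ.X i (co k) y) 0 := by
    intro k _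
    have := ((curve_diff Γ i y (co_smooth k) 0).hasDerivAt).pow (J k)
    simp only [curve_zero] at this
    exact this
  have h2 := (HasDerivAt.fun_finsetProd h).deriv
  simp only [curve_zero] at h2
  unfold HLG.X etaI at *
  rw [h2]
  simp only [Finset.sum_apply, Pi.smul_apply, Pi.mul_apply, smul_eq_mul]
  refine Finset.sum_congr rfl fun k _ => ?_
  have := eta_sub J k y
  unfold etaI at this
  rw [this]
  ring

lemma absI_sub (J : Fin d → ℕ) (k : Fin d) (hk : J k ≠ 0) :
    absI (J - Pi.single k 1) + 1 = absI J := by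
  unfold absI
  rw [← Finset.sum_erase_add _ _ (Finset.mem_univ k),
    ← Finset.sum_erase_add (a := k) Finset.univ J (Finset.mem_univ k), add_assoc]
  congr 1
  · refine Finset.sum_congr rfl fun j hj => ?_
    rw [Finset.mem_erase] at hj
    simp [Pi.single_apply, hj.1]
  · simp; omega

lemma X_eta_van (Γ : HLG d) (i : Fin d) (J : Fin d → ℕ) :
    ∃ R, Van Γ (absI J) R ∧
      Γ.X i (etaI J) = (J i : ℝ) • etaI (J - Pi.single i 1) + R := by
  refine ⟨∑ k, (J k : ℝ) • (etaI (J - Pi.single k 1) *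
    (Γ.X i (co k) + fun _ => -(Pi.single i (1 : ℝ) : Gc d) k)), ?_, ?_⟩
  · refine Van.sum _ _ fun k _ => ?_
    by_cases hk : J k = 0
    · simpa [hk] using Van.zero Γ _
    · rw [← absI_sub J k hk]
      refine Van.smul _ ((eta_van Γ _).mul (Van.one ?_ ?_))
      · exact (X_smooth Γ i (co_smooth k)).add contDiff_const
      · simp [X_co_one]
  · rw [X_eta]
    funext y
    simp only [Finset.sum_apply, Pi.smul_apply, Pi.mul_apply, smul_eq_mul, Pi.add_apply,
      mul_add, Finset.sum_add_distrib]
    have : ∑ k, (J k : ℝ) * (etaI (J - Pi.single k 1) y * -(Pi.single i (1 : ℝ) : Gc d) k)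
        = - ((J i : ℝ) * etaI (J - Pi.single i 1) y) := by
      rw [Finset.sum_eq_single i]
      · simp
      · intro b _ hb; simp [Pi.single_apply, hb]
      · simp
    rw [this]; ring

/-- Iterated derivative along a word. -/
def XW (Γ : HLG d) (w : List (Fin d)) (f : Gc d → ℝ) : Gc d → ℝ := w.foldr (fun i g => Γ.X i g) f

lemma XW_append (Γ : HLG d) (u v : List (Fin d)) (f : Gc d → ℝ) :
    XW Γ (u ++ v) f = XW Γ u (XW Γ v f) := by simp [XW]

lemma XW_smooth (Γ : HLG d) (w : List (Fin d)) {f : Gc d → ℝ} (hf : Sm f) : Sm (XW Γ w f) := by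
  induction w with
  | nil => exact hf
  | cons i w ih => exact X_smooth Γ i ih

lemma XW_add (Γ : HLG d) (w : List (Fin d)) {f g : Gc d → ℝ} (hf : Sm f) (hg : Sm g) :
    XW Γ w (f + g) = XW Γ w f + XW Γ w g := by
  induction w with
  | nil => rfl
  | cons i w ih =>
    change Γ.X i (XW Γ w (f + g)) = _
    rw [ih, X_add Γ i (XW_smooth Γ w hf) (XW_smooth Γ w hg)]; rfl

lemma XW_smul (Γ : HLG d) (w : List (Fin d)) (a : ℝ) (f : Gc d → ℝ) :
    XW Γ w (a • f) = a • XW Γ w f := by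
  induction w with
  | nil => rfl
  | cons i w ih =>
    change Γ.X i (XW Γ w (a • f)) = _
    rw [ih, X_smul]; rfl

lemma XW_sum (Γ : HLG d) (w : List (Fin d)) {ι : Type*} (s : Finset ι) (a : ι → ℝ)
    (f : ι → Gc d → ℝ) (h : ∀ j, Sm (f j)) :
    XW Γ w (∑ j ∈ s, a j • f j) = ∑ j ∈ s, a j • XW Γ w (f j) ∧ Sm (∑ j ∈ s, a j • f j) := by
  induction s using Finset.induction_on with
  | empty =>
    refine ⟨by simpa using XW_smul Γ w 0 0, ?_⟩
    simpa using zero_sm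
  | insert b s hb ih =>
    rw [Finset.sum_insert hb, Finset.sum_insert hb]
    refine ⟨?_, ((h b).smul _).add ih.2⟩
    rw [XW_add Γ w ((h b).smul _) ih.2, XW_smul, ih.1]

lemma XW_van (Γ : HLG d) (n : ℕ) : ∀ (w : List (Fin d)), w.length = n → ∀ (f : Gc d → ℝ),
    Van Γ (n + 1) f → XW Γ w f Γ.one = 0 := by
  induction n with
  | zero =>
    intro w hw f hf
    rw [List.length_eq_zero_iff] at hw
    subst hw
    exact hf.2.1
  | succ n ih =>
    intro w hw f hf
    rcases List.eq_nil_or_concat w with rfl | ⟨u, i, rfl⟩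
    · simp at hw
    · rw [List.concat_eq_append, XW_append]
      exact ih u (by simpa using hw) _ (hf.2.2 i)

lemma Van.mono {Γ : HLG d} {k l : ℕ} (h : k ≤ l) {f : Gc d → ℝ} (hf : Van Γ l f) :
    Van Γ k f := by
  induction l, h using Nat.le_induction with
  | base => exact hf
  | succ l _ ih => exact ih hf.pred

lemma XW_eta_lt (Γ : HLG d) (w : List (Fin d)) (J : Fin d → ℕ) (h : w.length < absI J) :
    XW Γ w (etaI J) Γ.one = 0 :=
  XW_van Γ _ w rfl _ ((eta_van Γ J).mono h)

lemma XW_eta_eq (Γ : HLG d) (n : ℕ) : ∀ (w : List (Fin d)) (J : Fin d → ℕ), w.length = n →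
    absI J = n →
    ((∀ i, w.count i = J i) → 0 < XW Γ w (etaI J) Γ.one) ∧
    ((¬ ∀ i, w.count i = J i) → XW Γ w (etaI J) Γ.one = 0) := by
  induction n with
  | zero =>
    intro w J hw hJ
    rw [List.length_eq_zero_iff] at hw
    subst hw
    have h0 : ∀ i, J i = 0 := by simpa [absI] using hJ
    refine ⟨fun _ => ?_, fun h => ?_⟩
    · simp [XW, etaI, h0]
    · simp [h0] at h
  | succ n ih =>
    intro w J hw hJ
    rcases List.eq_nil_or_concat w with rfl | ⟨u, i, rfl⟩
    · simp at hw
    rw [List.concat_eq_append] at *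
    have hu : u.length = n := by simpa using hw
    obtain ⟨R, hR, hX⟩ := X_eta_van Γ i J
    have e : XW Γ (u ++ [i]) (etaI J) Γ.one
        = (J i : ℝ) * XW Γ u (etaI (J - Pi.single i 1)) Γ.one := by
      rw [XW_append]
      change XW Γ u (Γ.X i (etaI J)) Γ.one = _
      rw [hX, XW_add Γ u ((etaI_smooth _).smul _) hR.sm, XW_smul]
      rw [hJ] at hR
      simp [XW_van Γ n u hu R hR]
    rw [e]
    by_cases hi : J i = 0
    · refine ⟨fun h => ?_, fun _ => by simp [hi]⟩
      have := h i
      simp [hi] at this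
    · have hA := absI_sub J i hi
      have := ih u (J - Pi.single i 1) hu (by omega)
      have hiff : (∀ j, (u ++ [i]).count j = J j) ↔
          ∀ j, u.count j = (J - Pi.single i 1 : Fin d → ℕ) j := by
        refine forall_congr' fun j => ?_
        by_cases hj : j = i
        · subst hj; simp; omega
        · have : i ≠ j := fun h => hj h.symm
          simp [Pi.single_apply, hj, List.count_singleton, this]
      rw [hiff]
      refine ⟨fun h => mul_pos (by exact_mod_cast Nat.pos_of_ne_zero hi) (this.1 h),
        fun h => by rw [this.2 h, mul_zero]⟩

/-- The word of a multi-index. -/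
def word (I : Fin d → ℕ) : List (Fin d) :=
  (List.finRange d).flatMap fun j => List.replicate (I j) j

lemma XW_replicate (Γ : HLG d) (j : Fin d) (n : ℕ) (f : Gc d → ℝ) :
    XW Γ (List.replicate n j) f = (Γ.X j)^[n] f := by
  induction n with
  | zero => rfl
  | succ n ih =>
    rw [Function.iterate_succ_apply', ← ih]; rfl

lemma XI_eq (Γ : HLG d) (I : Fin d → ℕ) (f : Gc d → ℝ) : Γ.XI I f = XW Γ (word I) f := by
  unfold HLG.XI word
  induction (List.finRange d) with
  | nil => rfl
  | cons j l ih =>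
    rw [List.flatMap_cons, XW_append, ← ih, XW_replicate]; rfl

lemma sum_map_eq {M : Type*} [AddCommMonoid M] (g : Fin d → M) :
    ((List.finRange d).map g).sum = ∑ j, g j := by
  rw [← List.sum_ofFn, List.ofFn_eq_map]

lemma word_length (I : Fin d → ℕ) : (word I).length = absI I := by
  unfold word absI
  rw [List.length_flatMap, ← sum_map_eq]
  simp

lemma word_count (I : Fin d → ℕ) (i : Fin d) : (word I).count i = I i := by
  unfold word
  rw [List.count_flatMap, sum_map_eq]
  simp [List.count_replicate]

lemma word_s (Γ : HLG d) (I : Fin d → ℕ) : ((word I).map Γ.s).sum = Γ.dI I := by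
  unfold word HLG.dI
  rw [← sum_map_eq]
  induction (List.finRange d) with
  | nil => simp
  | cons j l ih => simp [ih, mul_comm]

lemma X_dil (Γ : HLG d) (i : Fin d) (r : ℝ) (hr : 0 < r) (f : Gc d → ℝ) :
    Γ.X i (f ∘ Γ.dil r) = r ^ Γ.s i • (Γ.X i f ∘ Γ.dil r) := by
  funext y
  unfold HLG.X
  have : (fun t : ℝ => (f ∘ Γ.dil r) (Γ.mul y (Pi.single i t)))
      = fun t : ℝ => (fun u => f (Γ.mul (Γ.dil r y) (Pi.single i u))) (r ^ Γ.s i * t) := by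
    funext t
    have h := Γ.dil_mul r hr y (Pi.single i t)
    have h2 : (fun j => r ^ Γ.s j * (Pi.single i t : Gc d) j) = Pi.single i (r ^ Γ.s i * t) := by
      funext j
      by_cases hj : j = i
      · subst hj; simp
      · simp [Pi.single_apply, hj]
    rw [h2] at h
    exact congrArg f h
  rw [this, deriv_comp_mul_left (r ^ Γ.s i) (fun u => f (Γ.mul (Γ.dil r y) (Pi.single i u)))]
  simp

lemma XW_dil (Γ : HLG d) (r : ℝ) (hr : 0 < r) (w : List (Fin d)) (f : Gc d → ℝ) :
    XW Γ w (f ∘ Γ.dil r) = r ^ (w.map Γ.s).sum • (XW Γ w f ∘ Γ.dil r) := by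
  induction w with
  | nil => simp [XW]
  | cons i w ih =>
    change Γ.X i (XW Γ w (f ∘ Γ.dil r)) = _
    rw [ih, X_smul, X_dil Γ i r hr, smul_smul, List.map_cons, List.sum_cons, add_comm,
      Real.rpow_add hr]
    rfl

lemma eta_dil (Γ : HLG d) (r : ℝ) (hr : 0 < r) (J : Fin d → ℕ) :
    etaI J ∘ Γ.dil r = r ^ Γ.dI J • etaI J := by
  funext y
  simp only [etaI, HLG.dil, HLG.dI, Function.comp, Pi.smul_apply, smul_eq_mul]
  rw [Real.rpow_sum_of_pos hr, ← Finset.prod_mul_distrib]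
  refine Finset.prod_congr rfl fun j _ => ?_
  rw [mul_pow, Real.rpow_mul hr.le, Real.rpow_natCast]

lemma graded (Γ : HLG d) (I J : Fin d → ℕ) (h : Γ.dI I ≠ Γ.dI J) :
    Γ.XI I (etaI J) Γ.one = 0 := by
  rw [XI_eq]
  have h1 := XW_dil Γ 2 (by norm_num) (word I) (etaI J)
  rw [eta_dil Γ 2 (by norm_num), XW_smul, word_s] at h1
  have h2 := congrFun h1 Γ.one
  have h3 : Γ.dil 2 Γ.one = Γ.one := by
    rw [one_zero]; funext j; simp [HLG.dil]
  simp only [Pi.smul_apply, Function.comp, h3, smul_eq_mul] at h2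
  by_contra h0
  have h4 := mul_right_cancel₀ h0 h2
  apply h
  have := congrArg (Real.logb 2) h4
  rw [Real.logb_rpow (by norm_num) (by norm_num), Real.logb_rpow (by norm_num) (by norm_num)]
    at this
  exact this.symm

lemma diag_pos (Γ : HLG d) (I : Fin d → ℕ) : 0 < Γ.XI I (etaI I) Γ.one := by
  rw [XI_eq]
  exact (XW_eta_eq Γ _ (word I) I (word_length I) rfl).1 (word_count I)

lemma off_diag (Γ : HLG d) (I J : Fin d → ℕ) (hne : J ≠ I) (h : absI I ≤ absI J) :
    Γ.XI I (etaI J) Γ.one = 0 := by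
  rw [XI_eq]
  rcases h.lt_or_eq with h | h
  · exact XW_eta_lt Γ _ _ (by rwa [word_length])
  · refine (XW_eta_eq Γ _ (word I) J (word_length I) h.symm).2 fun h' => hne ?_
    funext i
    rw [← h' i, word_count]

lemma XI_poly (Γ : HLG d) (I : Fin d → ℕ) (c : (Fin d → ℕ) →₀ ℝ) (S : Finset (Fin d → ℕ))
    (hS : c.support ⊆ S) :
    Γ.XI I (polyFun c) Γ.one = ∑ J ∈ S, c J * Γ.XI I (etaI J) Γ.one := by
  have : polyFun c = ∑ J ∈ S, c J • etaI J := by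
    funext z
    simp only [polyFun, Finset.sum_apply, Pi.smul_apply, smul_eq_mul]
    exact Finsupp.sum_of_support_subset _ hS _ (by simp)
  rw [this]
  simp only [XI_eq]
  rw [(XW_sum Γ (word I) S c etaI etaI_smooth).1]
  simp

lemma finite_below (Γ : HLG d) (δ : ℝ) : {I : Fin d → ℕ | Γ.dI I < δ}.Finite := by
  refine (Set.finite_Iic (fun _ : Fin d => ⌈δ⌉₊)).subset fun I hI j => ?_
  have h1 : Γ.s j * (I j : ℝ) ≤ Γ.dI I :=
    Finset.single_le_sum (f := fun j => Γ.s j * (I j : ℝ))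
      (fun j _ => mul_nonneg (by linarith [Γ.one_le_s j]) (Nat.cast_nonneg _)) (Finset.mem_univ j)
  have h2 : (I j : ℝ) ≤ Γ.s j * (I j : ℝ) :=
    le_mul_of_one_le_left (Nat.cast_nonneg _) (Γ.one_le_s j)
  have h3 : (I j : ℝ) ≤ (⌈δ⌉₊ : ℝ) := by
    have := Nat.le_ceil δ
    have : Γ.dI I < δ := hI
    linarith
  exact_mod_cast h3

lemma coeff_bound (Γ : HLG d) (δ : ℝ) (n : ℕ) : ∀ I : Fin d → ℕ, absI I = n → Γ.dI I < δ →
    ∃ K : ℝ, 0 ≤ K ∧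
      ∀ c : (Fin d → ℕ) →₀ ℝ, (∀ I ∈ c.support, Γ.dI I < δ) →
      ∀ ε ∈ Set.Icc (0 : ℝ) 1,
        (∀ I : Fin d → ℕ, Γ.dI I < δ →
          |Γ.XI I (polyFun c) Γ.one| ≤ ε ^ (δ - Γ.dI I)) →
        |c I| ≤ K * ε ^ (δ - Γ.dI I) := by
  induction n using Nat.strong_induction_on with
  | _ n ih =>
    intro I hI hd
    have hex : ∀ J : Fin d → ℕ, ∃ K : ℝ, 0 ≤ K ∧ (absI J < n → Γ.dI J < δ →
      ∀ c : (Fin d → ℕ) →₀ ℝ, (∀ I ∈ c.support, Γ.dI I < δ) →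
      ∀ ε ∈ Set.Icc (0 : ℝ) 1,
        (∀ I : Fin d → ℕ, Γ.dI I < δ →
          |Γ.XI I (polyFun c) Γ.one| ≤ ε ^ (δ - Γ.dI I)) →
        |c J| ≤ K * ε ^ (δ - Γ.dI J)) := by
      intro J
      by_cases h : absI J < n ∧ Γ.dI J < δ
      · obtain ⟨K, h0, hK⟩ := ih _ h.1 J rfl h.2
        exact ⟨K, h0, fun _ _ => hK⟩
      · exact ⟨0, le_rfl, fun h1 h2 => absurd ⟨h1, h2⟩ h⟩
    choose K hK0 hK using hex
    set S := (finite_below Γ δ).toFinset with hSdef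
    have hIS : I ∈ S := by simpa [hSdef] using hd
    set D := Γ.XI I (etaI I) Γ.one with hD
    have hDpos : 0 < D := diag_pos Γ I
    set T := ∑ J ∈ S.erase I, K J * |Γ.XI I (etaI J) Γ.one| with hT
    have hT0 : 0 ≤ T := Finset.sum_nonneg fun J _ => mul_nonneg (hK0 J) (abs_nonneg _)
    refine ⟨(1 + T) / D, by positivity, ?_⟩
    intro c hc ε hε hb
    have hsub : c.support ⊆ S := fun J hJ => by simpa [hSdef] using hc J hJ
    have hx := XI_poly Γ I c S hsub
    rw [← Finset.add_sum_erase S _ hIS, ← hD] at hx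
    have hε0 : 0 ≤ ε ^ (δ - Γ.dI I) := Real.rpow_nonneg hε.1 _
    have hrest : |∑ J ∈ S.erase I, c J * Γ.XI I (etaI J) Γ.one| ≤ T * ε ^ (δ - Γ.dI I) := by
      refine (Finset.abs_sum_le_sum_abs _ _).trans ?_
      rw [hT, Finset.sum_mul]
      refine Finset.sum_le_sum fun J hJ => ?_
      rw [Finset.mem_erase] at hJ
      rw [abs_mul]
      by_cases hz : Γ.XI I (etaI J) Γ.one = 0
      · simp [hz]
      · have hdeg : Γ.dI I = Γ.dI J := by
          by_contra h; exact hz (graded Γ I J h)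
        have hlt : absI J < n := by
          by_contra h
          exact hz (off_diag Γ I J hJ.1 (by omega))
        have := hK J hlt (by rwa [← hdeg]) c hc ε hε hb
        rw [← hdeg] at this
        calc |c J| * |Γ.XI I (etaI J) Γ.one|
            ≤ (K J * ε ^ (δ - Γ.dI I)) * |Γ.XI I (etaI J) Γ.one| :=
              mul_le_mul_of_nonneg_right this (abs_nonneg _)
          _ = _ := by ring
    have hb' := hb I hd
    have hcD : |c I| * D ≤ (1 + T) * ε ^ (δ - Γ.dI I) := by
      have e : c I * D = Γ.XI I (polyFun c) Γ.one
          - ∑ J ∈ S.erase I, c J * Γ.XI I (etaI J) Γ.one := by rw [hx]; ring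
      have : |c I| * D = |c I * D| := by rw [abs_mul, abs_of_pos hDpos]
      rw [this, e]
      refine (abs_sub _ _).trans ?_
      linarith
    rw [div_mul_eq_mul_div, le_div_iff₀ hDpos]
    exact hcD

/-- **Coefficient bound for homogeneous polynomials from pointwise derivative bounds.**
Let `δ > 0` and `P = Σ_{d(I)<δ} a_I 𝛈^I` with realisation `p = Σ a_I η^I`. If, for some
`ε ∈ [0,1]`, `|X^I p(e)| ≤ ε^{δ−d(I)}` for all `d(I) < δ`, then `|P|_a ≲_{δ,𝔾} ε^{δ−a}`
for every `a ≤ δ`. -/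
theorem poly_coefficient_bound (Γ : HLG d) (δ : ℝ) (hδ : 0 < δ) :
    ∃ C : ℝ, 0 < C ∧
      ∀ c : (Fin d → ℕ) →₀ ℝ, (∀ I ∈ c.support, Γ.dI I < δ) →
      ∀ ε ∈ Set.Icc (0 : ℝ) 1,
        (∀ I : Fin d → ℕ, Γ.dI I < δ →
          |Γ.XI I (polyFun c) Γ.one| ≤ ε ^ (δ - Γ.dI I)) →
        ∀ a : ℝ, a ≤ δ → gradeNormC Γ c a ≤ C * ε ^ (δ - a) := by
  have hex : ∀ J : Fin d → ℕ, ∃ K : ℝ, 0 ≤ K ∧ (Γ.dI J < δ →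
      ∀ c : (Fin d → ℕ) →₀ ℝ, (∀ I ∈ c.support, Γ.dI I < δ) →
      ∀ ε ∈ Set.Icc (0 : ℝ) 1,
        (∀ I : Fin d → ℕ, Γ.dI I < δ →
          |Γ.XI I (polyFun c) Γ.one| ≤ ε ^ (δ - Γ.dI I)) →
        |c J| ≤ K * ε ^ (δ - Γ.dI J)) := by
    intro J
    by_cases h : Γ.dI J < δ
    · obtain ⟨K, h0, hK⟩ := coeff_bound Γ δ _ J rfl h
      exact ⟨K, h0, fun _ => hK⟩
    · exact ⟨0, le_rfl, fun h1 => absurd h1 h⟩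
  choose K hK0 hK using hex
  set S := (finite_below Γ δ).toFinset with hSdef
  have hS0 : 0 ≤ ∑ J ∈ S, K J := Finset.sum_nonneg fun J _ => hK0 J
  refine ⟨1 + ∑ J ∈ S, K J, by linarith, ?_⟩
  intro c hc ε hε hb a _
  have hε0 : 0 ≤ ε ^ (δ - a) := Real.rpow_nonneg hε.1 _
  have h1 : gradeNormC Γ c a ≤
      ∑ I ∈ c.support.filter (fun I => Γ.dI I = a), K I * ε ^ (δ - a) := by
    unfold gradeNormC
    refine Finset.sum_le_sum fun I hI => ?_
    rw [Finset.mem_filter] at hI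
    have := hK I (hc I hI.1) c hc ε hε hb
    rwa [hI.2] at this
  refine h1.trans ?_
  rw [← Finset.sum_mul]
  refine mul_le_mul_of_nonneg_right ?_ hε0
  have h2 : ∑ I ∈ c.support.filter (fun I => Γ.dI I = a), K I ≤ ∑ J ∈ S, K J := by
    refine Finset.sum_le_sum_of_subset_of_nonneg (fun J hJ => ?_) fun J _ _ => hK0 J
    rw [Finset.mem_filter] at hJ
    simpa [hSdef] using hc J hJ.1
  linarith

end HomLie
end
end
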